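/- arXiv:1306.1724 — 3 statements merged into one kernel-verified Lean document; each statement's English description precedes it below -/
import Mathlib

section
/- Let w be a weight with w^{-1/(p-1)} ∈ L¹, 1 < p < ∞. The following are equivalent: (a) for every stopping time τ and f ∈ L^p(w), (∫_{{τ<∞}} |f_τ|^p v dμ)^{1/p} ≤ C‖f‖_{L^p(w)}; (b) the martingale maximal operator Mf = sup_n |E_n f| satisfies ‖Mf‖_{L^{p,∞}(v)} ≤ C‖f‖_{L^p(w)}; (c) (v, w) satisfies the martingale A_p condition sup_n E_n(v) E_n(w^{-1/(p-1)})^{p-1} ≤ C. -/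
open MeasureTheory Filter ENNReal

noncomputable section

lemma aux_young {p g W u : ℝ} (hp : 1 < p) (hg : 0 ≤ g) (hW : 0 < W) (hu : 0 ≤ u) :
    p * u ^ (p - 1) * g ≤ g ^ p * W + (p - 1) * u ^ p * W ^ (-(1 / (p - 1))) := by
  have hp0 : 0 < p := by linarith
  have hp1 : 0 < p - 1 := by linarith
  have hpq : p.HolderConjugate (p / (p - 1)) := Real.HolderConjugate.conjExponent hp
  have h := Real.young_inequality_of_nonneg (a := g * W ^ (1 / p))
    (b := u ^ (p - 1) * W ^ (-(1 / p))) (by positivity) (by positivity) hpq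
  have e1 : (g * W ^ (1 / p)) ^ p = g ^ p * W := by
    rw [Real.mul_rpow hg (by positivity), ← Real.rpow_mul hW.le]
    rw [one_div, inv_mul_cancel₀ hp0.ne', Real.rpow_one]
  have e2 : (u ^ (p - 1) * W ^ (-(1 / p))) ^ (p / (p - 1)) = u ^ p * W ^ (-(1 / (p - 1))) := by
    rw [Real.mul_rpow (by positivity) (by positivity), ← Real.rpow_mul hW.le, ← Real.rpow_mul hu]
    congr 2 <;> field_simp
  have e3 : g * W ^ (1 / p) * (u ^ (p - 1) * W ^ (-(1 / p))) = u ^ (p - 1) * g := by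
    rw [Real.rpow_neg hW.le]
    field_simp
  rw [e1, e2, e3] at h
  have h2 := mul_le_mul_of_nonneg_left h hp0.le
  have e4 : p * (g ^ p * W / p + u ^ p * W ^ (-(1 / (p - 1))) / (p / (p - 1)))
      = g ^ p * W + (p - 1) * u ^ p * W ^ (-(1 / (p - 1))) := by
    field_simp
  rw [e4] at h2
  linarith

lemma aux_null {Ω : Type*} {m0 : MeasurableSpace Ω} {μ : Measure Ω} {g : Ω → ℝ} {A : Set Ω}
    (hA : MeasurableSet A) (hg : Integrable g μ) (hpos : ∀ x ∈ A, 0 < g x)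
    (hle : ∫ x in A, g x ∂μ ≤ 0) : μ A = 0 := by
  have h0 : 0 ≤ᵐ[μ.restrict A] g := by
    filter_upwards [ae_restrict_mem hA] with x hx using (hpos x hx).le
  have := (setIntegral_pos_iff_support_of_nonneg_ae h0 hg.integrableOn).not.mp (not_lt.mpr hle)
  have h1 : Function.support g ∩ A = A := by
    apply Set.inter_eq_right.mpr
    intro x hx
    exact (hpos x hx).ne'
  rw [h1] at this
  simpa using this

lemma aux_pos {Ω : Type*} {m m0 : MeasurableSpace Ω} {μ : Measure Ω} [IsProbabilityMeasure μ]
    (hm : m ≤ m0) {σ : Ω → ℝ} (hσ : ∀ x, 0 < σ x) (hσI : Integrable σ μ) :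
    ∀ᵐ x ∂μ, 0 < (μ[σ|m]) x := by
  have hA : MeasurableSet[m] {x | (μ[σ|m]) x ≤ 0} :=
    measurableSet_le stronglyMeasurable_condExp.measurable measurable_const
  have h := setIntegral_condExp hm hσI hA
  have : μ {x | (μ[σ|m]) x ≤ 0} = 0 := by
    apply aux_null (hm _ hA) hσI (fun x _ => hσ x)
    rw [← h]
    exact setIntegral_nonpos (hm _ hA) (fun x hx => hx)
  rw [ae_iff]
  simpa using this

lemma aux_holder {Ω : Type*} {m m0 : MeasurableSpace Ω} {μ : Measure Ω} [IsProbabilityMeasure μ]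
    (hm : m ≤ m0) {w : Ω → ℝ} (hw : ∀ x, 0 < w x) {p : ℝ} (hp : 1 < p)
    (hσI : Integrable (fun x => w x ^ (-(1 / (p - 1)))) μ)
    {f : Ω → ℝ} (hf : Integrable f μ) (hfw : Integrable (fun x => |f x| ^ p * w x) μ) :
    ∀ᵐ x ∂μ, |(μ[f|m]) x| ^ p ≤ (μ[fun x => |f x| ^ p * w x|m]) x *
      (μ[fun x => w x ^ (-(1 / (p - 1)))|m]) x ^ (p - 1) := by
  have key : ∀ u : ℚ, ∀ᵐ x ∂μ, 
      p * |(u:ℝ)| ^ (p - 1) * |(μ[f|m]) x| ≤ (μ[fun x => |f x| ^ p * w x|m]) x +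
      (p - 1) * |(u:ℝ)| ^ p * (μ[fun x => w x ^ (-(1 / (p - 1)))|m]) x := by
    intro u
    set a := p * |(u:ℝ)| ^ (p - 1)
    set b := (p - 1) * |(u:ℝ)| ^ p
    have ha : 0 ≤ a := by positivity
    have h1 := condExp_mono (m := m) (hf.abs.smul a) (hfw.add (hσI.smul b))
      (Eventually.of_forall fun x => by
        simpa using aux_young hp (abs_nonneg (f x)) (hw x) (abs_nonneg (u:ℝ)))
    have h2 := condExp_add (m := m) hfw (hσI.smul b)
    have h3 := condExp_smul (μ := μ) b (fun x => w x ^ (-(1 / (p - 1)))) m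
    have h4 := condExp_smul (μ := μ) a (fun x => |f x|) m
    have h5 := norm_condExp_le (μ := μ) (m := m) f
    filter_upwards [h1, h2, h3, h4, h5] with x h1 h2 h3 h4 h5
    rw [h2, h4] at h1
    simp only [Pi.add_apply, h3, Pi.smul_apply, smul_eq_mul] at h1
    simp only [Real.norm_eq_abs] at h5
    exact (mul_le_mul_of_nonneg_left h5 ha).trans h1
  have hs := aux_pos hm (fun x => Real.rpow_pos_of_pos (hw x) (-(1 / (p - 1)))) hσI
  filter_upwards [ae_all_iff.mpr key, hs] with x hx hs
  set F := (μ[fun x => |f x| ^ p * w x|m]) x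
  set s := (μ[fun x => w x ^ (-(1 / (p - 1)))|m]) x
  set y := |(μ[f|m]) x|
  have hy : 0 ≤ y := abs_nonneg _
  have hall : ∀ u : ℝ, p * |u| ^ (p - 1) * y ≤ F + (p - 1) * |u| ^ p * s := by
    intro u
    have c1 : Continuous fun u : ℝ => |u| ^ (p - 1) :=
      continuous_abs.rpow_const (fun _ => Or.inr (by linarith))
    have c2 : Continuous fun u : ℝ => |u| ^ p :=
      continuous_abs.rpow_const (fun _ => Or.inr (by linarith))
    have hc : IsClosed {u : ℝ | p * |u| ^ (p - 1) * y ≤ F + (p - 1) * |u| ^ p * s} :=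
      isClosed_le (by fun_prop) (by fun_prop)
    have hd : Dense (Set.range ((↑) : ℚ → ℝ)) := Rat.isDenseEmbedding_coe_real.dense
    have := hc.closure_subset_iff.mpr (show Set.range ((↑) : ℚ → ℝ) ⊆ _ by
      rintro _ ⟨q, rfl⟩; exact hx q)
    exact this (hd u)
  have h := hall (y / s)
  rw [abs_of_nonneg (by positivity), Real.div_rpow hy hs.le, Real.div_rpow hy hs.le] at h
  rcases hy.eq_or_lt with h0 | h0
  · rw [← h0] at h ⊢
    rw [Real.zero_rpow (by linarith)] at h ⊢
    have hF : 0 ≤ F := by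
      rw [Real.zero_rpow (by linarith : p ≠ 0)] at h
      simpa using h
    exact mul_nonneg hF (Real.rpow_nonneg hs.le _)
  have e1 : y ^ p = y ^ (p - 1) * y := by
    rw [← Real.rpow_add_one h0.ne']; ring_nf
  have e2 : s ^ p = s ^ (p - 1) * s := by
    rw [← Real.rpow_add_one hs.ne']; ring_nf
  have hsp : 0 < s ^ (p - 1) := by positivity
  rw [e1, e2] at h
  rw [e1, ← div_le_iff₀ hsp]
  have e3 : (p - 1) * (y ^ (p - 1) * y / (s ^ (p - 1) * s)) * s
     = (p - 1) * (y ^ (p - 1) * y / s ^ (p - 1)) := by field_simp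
  have e4 : p * (y ^ (p - 1) / s ^ (p - 1)) * y = p * (y ^ (p - 1) * y / s ^ (p - 1)) := by
    field_simp
  rw [e3, e4] at h
  linarith

lemma aux_toC {Ω : Type*} {m m0 : MeasurableSpace Ω} {μ : Measure Ω} [IsProbabilityMeasure μ]
    (hm : m ≤ m0) {v σ : Ω → ℝ} (hσ : ∀ x, 0 < σ x) (hσI : Integrable σ μ) (hvI : Integrable v μ)
    (hv : ∀ x, 0 < v x)
    {p D : ℝ} (hp : 1 < p)
    (H : ∀ t : ℝ, 0 < t → ∀ A : Set Ω, MeasurableSet[m] A →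
      (∀ x ∈ A, t < (μ[σ|m]) x ∧ (μ[σ|m]) x ≤ 2 * t) →
      t ^ p * ∫ x in A, v x ∂μ ≤ D * ∫ x in A, σ x ∂μ) :
    ∀ᵐ x ∂μ, (μ[v|m]) x * (μ[σ|m]) x ^ (p - 1) ≤ 2 ^ p * D := by
  have key : ∀ k : ℤ, ∀ᵐ x ∂μ, (2:ℝ) ^ k < (μ[σ|m]) x ∧ (μ[σ|m]) x ≤ 2 * 2 ^ k →
      ((2:ℝ) ^ k) ^ p * (μ[v|m]) x ≤ D * (μ[σ|m]) x := by
    intro k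
    set t : ℝ := (2:ℝ) ^ k
    have ht : 0 < t := by positivity
    have ms : Measurable[m] (μ[σ|m]) := stronglyMeasurable_condExp.measurable
    have mv : Measurable[m] (μ[v|m]) := stronglyMeasurable_condExp.measurable
    set A : Set Ω := {x | t < (μ[σ|m]) x} ∩ {x | (μ[σ|m]) x ≤ 2 * t} ∩
      {x | D * (μ[σ|m]) x < t ^ p * (μ[v|m]) x}
    have hA : MeasurableSet[m] A :=
      ((measurableSet_lt measurable_const ms).inter (measurableSet_le ms measurable_const)).inter
        (measurableSet_lt (ms.const_mul D) (mv.const_mul _))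
    have h := H t ht A hA (fun x hx => hx.1)
    rw [← setIntegral_condExp hm hvI hA, ← setIntegral_condExp hm hσI hA] at h
    have hn : μ A = 0 := by
      apply aux_null (hm _ hA) (g := fun x => t ^ p * (μ[v|m]) x - D * (μ[σ|m]) x)
        ((integrable_condExp.const_mul _).sub (integrable_condExp.const_mul _))
      · intro x hx
        exact sub_pos.mpr hx.2
      · rw [integral_sub (Integrable.const_mul (integrable_condExp (f := v)).restrict _)
          (Integrable.const_mul (integrable_condExp (f := σ)).restrict _), integral_const_mul, integral_const_mul]
        linarith
    rw [ae_iff]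
    convert hn using 2
    ext x
    simp [A, and_assoc]
  filter_upwards [ae_all_iff.mpr key, aux_pos hm hσ hσI, aux_pos hm hv hvI] with x hx hs hvx
  obtain ⟨k, hk⟩ := exists_mem_Ioc_zpow hs (one_lt_two)
  have hk2 : (μ[σ|m]) x ≤ 2 * 2 ^ k := by
    have := hk.2
    rwa [zpow_add_one₀ two_ne_zero, mul_comm] at this
  have h := hx k ⟨hk.1, hk2⟩
  set s := (μ[σ|m]) x
  have e2 : s ^ p = s ^ (p - 1) * s := by
    rw [← Real.rpow_add_one hs.ne']; ring_nf
  have h3 : s ^ p ≤ 2 ^ p * ((2:ℝ) ^ k) ^ p := by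
    rw [← Real.mul_rpow (by norm_num) (by positivity)]
    exact Real.rpow_le_rpow hs.le hk2 (by linarith)
  have h2p : (0:ℝ) < 2 ^ p := by positivity
  rw [← mul_le_mul_iff_left₀ hs]
  calc _ = (μ[v|m]) x * s ^ p := by rw [e2]; ring
    _ ≤ (μ[v|m]) x * (2 ^ p * ((2:ℝ) ^ k) ^ p) := by gcongr
    _ = 2 ^ p * (((2:ℝ) ^ k) ^ p * (μ[v|m]) x) := by ring
    _ ≤ 2 ^ p * (D * s) := by gcongr
    _ = _ := by ring

lemma aux_piece {Ω : Type*} {m m0 : MeasurableSpace Ω} {μ : Measure Ω} [IsProbabilityMeasure μ]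
    (hm : m ≤ m0) {v w : Ω → ℝ} (hw : ∀ x, 0 < w x) (hv : ∀ x, 0 < v x) {p C : ℝ} (hp : 1 < p)
    (hvI : Integrable v μ)
    (hσI : Integrable (fun x => w x ^ (-(1 / (p - 1)))) μ)
    (hC : ∀ᵐ x ∂μ, (μ[v|m]) x * (μ[fun y => w y ^ (-(1 / (p - 1)))|m]) x ^ (p - 1) ≤ C)
    {f : Ω → ℝ} (hf : Integrable f μ) (hfw : Integrable (fun x => |f x| ^ p * w x) μ)
    {B : Set Ω} (hB : MeasurableSet[m] B) {K : ℝ} (hK : ∀ x ∈ B, |(μ[f|m]) x| ≤ K) :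
    ∫⁻ x in B, ENNReal.ofReal (|(μ[f|m]) x| ^ p * v x) ∂μ ≤
      ENNReal.ofReal C * ∫⁻ x in B, ENNReal.ofReal (|f x| ^ p * w x) ∂μ := by
  have hB0 := hm _ hB
  set g : Ω → ℝ := B.indicator (fun x => |(μ[f|m]) x| ^ p) with hg
  have mf : Measurable[m] (fun x => |(μ[f|m]) x| ^ p) := by
    have : Measurable[m] (μ[f|m]) := stronglyMeasurable_condExp.measurable
    exact (continuous_abs.measurable.comp this).pow_const p
  have mg : Measurable[m] g := mf.indicator hB
  have gn : ∀ x, 0 ≤ g x := fun x => Set.indicator_nonneg (fun _ _ => by positivity) x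
  have gb : ∀ x, ‖g x‖ ≤ |K| ^ p := by
    intro x
    rw [Real.norm_of_nonneg (gn x)]
    by_cases hx : x ∈ B
    · simp only [hg, Set.indicator_of_mem hx]
      exact Real.rpow_le_rpow (abs_nonneg _) ((hK x hx).trans (le_abs_self K)) (by linarith)
    · simp only [hg, Set.indicator_of_notMem hx]; positivity
  have gv : Integrable (g * v) μ :=
    hvI.bdd_mul (mg.mono hm le_rfl).aestronglyMeasurable (Eventually.of_forall gb)
  have pull := condExp_mul_of_stronglyMeasurable_left mg.stronglyMeasurable gv hvI
  have gEv : Integrable (g * μ[v|m]) μ := integrable_condExp.congr pull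
  have F0 : 0 ≤ᵐ[μ] μ[fun x => |f x| ^ p * w x|m] :=
    condExp_nonneg (Eventually.of_forall fun x => by have := hw x; simp only [Pi.zero_apply]; positivity)
  have hle : ∫ x, (g * v) x ∂μ ≤ C * ∫ x in B, |f x| ^ p * w x ∂μ := by
    rw [← integral_condExp hm, integral_congr_ae pull, ← setIntegral_condExp hm hfw hB,
      ← integral_const_mul, ← integral_indicator hB0]
    apply integral_mono_ae gEv ((integrable_condExp.const_mul C).indicator hB0)
    filter_upwards [hC, aux_holder hm hw hp hσI hf hfw, aux_pos hm hv hvI, F0] with x h1 h2 h3 h4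
    by_cases hx : x ∈ B
    · simp only [Pi.mul_apply, hg, Set.indicator_of_mem hx]
      simp only [Pi.zero_apply] at h4
      calc _ ≤ _ := mul_le_mul_of_nonneg_right h2 h3.le
        _ = (μ[fun x => |f x| ^ p * w x|m]) x * ((μ[v|m]) x * (μ[fun y => w y ^ (-(1 / (p - 1)))|m]) x ^ (p - 1)) := by ring
        _ ≤ (μ[fun x => |f x| ^ p * w x|m]) x * C := by gcongr
        _ = _ := by ring
    · simp [hg, hx]
  have eL : ∫⁻ x in B, ENNReal.ofReal (|(μ[f|m]) x| ^ p * v x) ∂μ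
      = ENNReal.ofReal (∫ x, (g * v) x ∂μ) := by
    rw [ofReal_integral_eq_lintegral_ofReal gv
      (Eventually.of_forall fun x => mul_nonneg (gn x) (hv x).le), ← lintegral_indicator hB0]
    congr 1; ext x
    by_cases hx : x ∈ B <;> simp [hg, hx]
  have fwn : ∀ x, 0 ≤ |f x| ^ p * w x := fun x => by have := hw x; positivity
  rw [eL, ← ofReal_integral_eq_lintegral_ofReal hfw.integrableOn (Eventually.of_forall fwn),
    ← ENNReal.ofReal_mul' (integral_nonneg fwn)]
  exact ENNReal.ofReal_le_ofReal hle

lemma aux_stop {Ω : Type*} {m0 : MeasurableSpace Ω} {μ : Measure Ω} [IsProbabilityMeasure μ]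
    (ℱ : Filtration ℕ m0) {v w : Ω → ℝ} (hw : ∀ x, 0 < w x) (hv : ∀ x, 0 < v x) {p C : ℝ}
    (hp : 1 < p) (hvI : Integrable v μ)
    (hσI : Integrable (fun x => w x ^ (-(1 / (p - 1)))) μ)
    (hC : ∀ n, ∀ᵐ x ∂μ,
      (μ[v|ℱ n]) x * (μ[fun y => w y ^ (-(1 / (p - 1)))|ℱ n]) x ^ (p - 1) ≤ C)
    (τ : Ω → ℕ∞) (hτ : ∀ n : ℕ, MeasurableSet[ℱ n] {x | τ x ≤ (n : ℕ∞)})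
    {f : Ω → ℝ} (hf : Integrable f μ) (hfw : Integrable (fun x => |f x| ^ p * w x) μ) :
    ∫⁻ x in {x | τ x ≠ ⊤}, ENNReal.ofReal (|(μ[f|ℱ (τ x).toNat]) x| ^ p * v x) ∂μ ≤
      ENNReal.ofReal C * ENNReal.ofReal (∫ x, |f x| ^ p * w x ∂μ) := by
  have hτe : ∀ n : ℕ, MeasurableSet[ℱ n] {x | τ x = (n : ℕ∞)} := by
    intro n
    cases n with
    | zero => simpa using hτ 0
    | succ k =>
      have : {x | τ x = ((k + 1 : ℕ) : ℕ∞)} = {x | τ x ≤ ((k + 1 : ℕ) : ℕ∞)} \ {x | τ x ≤ (k : ℕ∞)} := by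
        ext x
        simp only [Set.mem_ofPred_eq, Set.mem_sdiff, not_le]
        constructor
        · intro h; rw [h]; exact ⟨le_rfl, by exact_mod_cast Nat.lt_succ_self k⟩
        · rintro ⟨h1, h2⟩
          refine le_antisymm h1 ?_
          have := Order.add_one_le_of_lt h2
          exact_mod_cast this
      rw [this]
      exact (hτ (k + 1)).diff (ℱ.mono (Nat.le_succ k) _ (hτ k))
  set B : ℕ × ℕ → Set Ω := fun q => {x | τ x = (q.1 : ℕ∞)} ∩ {x | ⌊|(μ[f|ℱ q.1]) x|⌋₊ = q.2} with hBdef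
  have hB : ∀ q, MeasurableSet[ℱ q.1] (B q) := by
    intro q
    have : Measurable[ℱ q.1] (μ[f|ℱ q.1]) := stronglyMeasurable_condExp.measurable
    have h2 : Measurable[ℱ q.1] (fun x => ⌊|(μ[f|ℱ q.1]) x|⌋₊) := Nat.measurable_floor.comp (continuous_abs.measurable.comp this)
    exact (hτe q.1).inter (h2 (measurableSet_singleton q.2))
  have hU : {x | τ x ≠ ⊤} = ⋃ q, B q := by
    ext x
    simp only [Set.mem_ofPred_eq, Set.mem_iUnion, hBdef, Set.mem_inter_iff]
    constructor
    · intro h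
      obtain ⟨n, hn⟩ := ENat.ne_top_iff_exists.mp h
      exact ⟨(n, ⌊|(μ[f|ℱ n]) x|⌋₊), hn.symm, rfl⟩
    · rintro ⟨q, h, -⟩
      rw [h]; exact ENat.natCast_ne_top _
  have hdisj : Pairwise (Function.onFun Disjoint B) := by
    intro q r hqr
    apply Set.disjoint_left.mpr
    rintro x ⟨h1, h2⟩ ⟨h3, h4⟩
    apply hqr
    simp only [Set.mem_ofPred_eq] at h1 h2 h3 h4
    have e1 : q.1 = r.1 := by rw [h1] at h3; exact_mod_cast h3
    rw [e1] at h2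
    exact Prod.ext e1 (h2.symm.trans h4)
  have fwn : ∀ x, 0 ≤ |f x| ^ p * w x := fun x => by have := hw x; positivity
  rw [hU, lintegral_iUnion (fun q => ℱ.le _ _ (hB q)) hdisj]
  calc _ ≤ ∑' q, ENNReal.ofReal C * ∫⁻ x in B q, ENNReal.ofReal (|f x| ^ p * w x) ∂μ := by
        refine ENNReal.tsum_le_tsum fun q => ?_
        have hp1 := aux_piece (ℱ.le q.1) hw hv hp hvI hσI (hC q.1) hf hfw (hB q) (K := q.2 + 1)
          (fun x hx => by
            have h := hx.2
            simp only [Set.mem_ofPred_eq] at h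
            rw [← h]
            exact (Nat.lt_floor_add_one _).le)
        refine le_trans (le_of_eq ?_) hp1
        refine setLIntegral_congr_fun (ℱ.le _ _ (hB q)) ?_
        intro x hx
        have h := hx.1
        simp only [Set.mem_ofPred_eq] at h
        simp only [h, ENat.toNat_natCast]
    _ = ENNReal.ofReal C * ∫⁻ x in ⋃ q, B q, ENNReal.ofReal (|f x| ^ p * w x) ∂μ := by
        rw [ENNReal.tsum_mul_left, lintegral_iUnion (fun q => ℱ.le _ _ (hB q)) hdisj]
    _ ≤ _ := by
        gcongr
        rw [ofReal_integral_eq_lintegral_ofReal hfw (Eventually.of_forall fwn)]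
        exact setLIntegral_le_lintegral _ _

lemma aux_pow {p l C x y : ℝ} (hp : 1 < p) (hl : 0 ≤ l) (hC : 0 ≤ C) (hx : 0 ≤ x) (hy : 0 ≤ y) :
    l * x ^ (1 / p) ≤ C * y ^ (1 / p) ↔ l ^ p * x ≤ C ^ p * y := by
  have hp0 : 0 < p := by linarith
  rw [← Real.rpow_le_rpow_iff (z := p) (by positivity) (by positivity) hp0,
    Real.mul_rpow hl (by positivity), Real.mul_rpow hC (by positivity),
    ← Real.rpow_mul hx, ← Real.rpow_mul hy, one_div, inv_mul_cancel₀ hp0.ne', Real.rpow_one,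
    Real.rpow_one]

lemma aux_sigma {p W : ℝ} (hp : 1 < p) (hW : 0 < W) :
    |W ^ (-(1 / (p - 1)))| ^ p * W = W ^ (-(1 / (p - 1))) := by
  have hp1 : p - 1 ≠ 0 := by linarith
  rw [abs_of_pos (by positivity), ← Real.rpow_mul hW.le, ← Real.rpow_add_one hW.ne']
  congr 1
  field_simp
  ring

lemma aux_ind {Ω : Type*} {w : Ω → ℝ} (hw : ∀ x, 0 < w x) {p : ℝ} (hp : 1 < p) (A : Set Ω) :
    (fun x => |A.indicator (fun y => w y ^ (-(1 / (p - 1)))) x| ^ p * w x)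
      = A.indicator (fun y => w y ^ (-(1 / (p - 1)))) := by
  ext x
  by_cases hx : x ∈ A
  · simp only [Set.indicator_of_mem hx]
    exact aux_sigma hp (hw x)
  · simp only [Set.indicator_of_notMem hx]
    rw [abs_zero, Real.zero_rpow (by linarith), zero_mul]

theorem stmt_7
    {Ω : Type*} {m0 : MeasurableSpace Ω} {μ : Measure Ω} [IsProbabilityMeasure μ]
    (ℱ : Filtration ℕ m0) (hgen : m0 = ⨆ n, ℱ n)
    (v w : Ω → ℝ)
    (hv : ∀ x, 0 < v x) (hw : ∀ x, 0 < w x)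
    (hvI : Integrable v μ) (hwI : Integrable w μ)
    (p : ℝ) (hp : 1 < p)
    (hσI : Integrable (fun x => w x ^ (-(1 / (p - 1)))) μ) :
    ((∃ C : ℝ, 0 < C ∧
        ∀ τ : Ω → ℕ∞, (∀ n : ℕ, MeasurableSet[ℱ n] {x | τ x ≤ (n : ℕ∞)}) →
        ∀ f : Ω → ℝ, Integrable f μ → Integrable (fun x => |f x| ^ p * w x) μ →
          (∫ x in {x | τ x ≠ ⊤}, |(μ[f|ℱ (τ x).toNat]) x| ^ p * v x ∂μ) ^ (1 / p)
            ≤ C * (∫ x, |f x| ^ p * w x ∂μ) ^ (1 / p))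
      ↔ (∃ C : ℝ, 0 < C ∧
        ∀ f : Ω → ℝ, Integrable f μ → Integrable (fun x => |f x| ^ p * w x) μ →
        ∀ lam : ℝ, 0 < lam →
          lam * (∫ x in {x | ENNReal.ofReal lam <
              ⨆ n, ENNReal.ofReal |(μ[f|ℱ n]) x|}, v x ∂μ) ^ (1 / p)
            ≤ C * (∫ x, |f x| ^ p * w x ∂μ) ^ (1 / p)))
    ∧ ((∃ C : ℝ, 0 < C ∧
        ∀ τ : Ω → ℕ∞, (∀ n : ℕ, MeasurableSet[ℱ n] {x | τ x ≤ (n : ℕ∞)}) →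
        ∀ f : Ω → ℝ, Integrable f μ → Integrable (fun x => |f x| ^ p * w x) μ →
          (∫ x in {x | τ x ≠ ⊤}, |(μ[f|ℱ (τ x).toNat]) x| ^ p * v x ∂μ) ^ (1 / p)
            ≤ C * (∫ x, |f x| ^ p * w x ∂μ) ^ (1 / p))
      ↔ (∃ C : ℝ, 0 < C ∧ ∀ n : ℕ, ∀ᵐ x ∂μ,
          (μ[v|ℱ n]) x * (μ[fun y => w y ^ (-(1 / (p - 1)))|ℱ n]) x ^ (p - 1) ≤ C)) := by
  have hm := ℱ.le
  have fwn : ∀ f : Ω → ℝ, ∀ x, 0 ≤ |f x| ^ p * w x := fun f x => by have := hw x; positivity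
  have σpos : ∀ x, 0 < w x ^ (-(1 / (p - 1))) := fun x => Real.rpow_pos_of_pos (hw x) _
  have ac : (∃ C : ℝ, 0 < C ∧
        ∀ τ : Ω → ℕ∞, (∀ n : ℕ, MeasurableSet[ℱ n] {x | τ x ≤ (n : ℕ∞)}) →
        ∀ f : Ω → ℝ, Integrable f μ → Integrable (fun x => |f x| ^ p * w x) μ →
          (∫ x in {x | τ x ≠ ⊤}, |(μ[f|ℱ (τ x).toNat]) x| ^ p * v x ∂μ) ^ (1 / p)
            ≤ C * (∫ x, |f x| ^ p * w x ∂μ) ^ (1 / p)) →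
      (∃ C : ℝ, 0 < C ∧ ∀ n : ℕ, ∀ᵐ x ∂μ,
          (μ[v|ℱ n]) x * (μ[fun y => w y ^ (-(1 / (p - 1)))|ℱ n]) x ^ (p - 1) ≤ C) := by
    rintro ⟨C, hC, H⟩
    refine ⟨2 ^ p * C ^ p, by positivity, fun n => ?_⟩
    refine aux_toC (hm n) σpos hσI hvI hv hp ?_
    intro t ht A hA hAt
    have hA0 := hm n _ hA
    classical
    set τ : Ω → ℕ∞ := fun x => if x ∈ A then (n : ℕ∞) else ⊤ with hτd
    have hτ : ∀ k : ℕ, MeasurableSet[ℱ k] {x | τ x ≤ (k : ℕ∞)} := by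
      intro k
      by_cases hk : n ≤ k
      · have : {x | τ x ≤ (k : ℕ∞)} = A := by
          ext x
          by_cases hx : x ∈ A <;> simp [hτd, hx, hk]
        rw [this]
        exact ℱ.mono hk _ hA
      · have : {x | τ x ≤ (k : ℕ∞)} = ∅ := by
          ext x
          by_cases hx : x ∈ A <;> simp [hτd, hx] <;> omega
        rw [this]
        exact @MeasurableSet.empty _ (ℱ k)
    have hτA : {x | τ x ≠ ⊤} = A := by
      ext x
      by_cases hx : x ∈ A <;> simp [hτd, hx]
    set f : Ω → ℝ := A.indicator (fun y => w y ^ (-(1 / (p - 1)))) with hf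
    have hfI : Integrable f μ := hσI.indicator hA0
    have h := H τ hτ f hfI (by rw [aux_ind hw hp A]; exact hfI)
    rw [aux_ind hw hp A, hτA, integral_indicator hA0] at h
    rw [← one_mul ((∫ x in A, |(μ[f|ℱ (τ x).toNat]) x| ^ p * v x ∂μ) ^ (1 / p)), aux_pow hp zero_le_one hC.le
      (integral_nonneg fun x => by have := hv x; simp only [Pi.zero_apply]; positivity)
      (integral_nonneg fun x => (σpos x).le), Real.one_rpow, one_mul] at h
    refine le_trans ?_ h
    have hce := condExp_indicator (m := ℱ n) hσI hA
    have e1 : ∫ x in A, |(μ[f|ℱ (τ x).toNat]) x| ^ p * v x ∂μ =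
        ∫ x in A, |(μ[fun y => w y ^ (-(1 / (p - 1)))|ℱ n]) x| ^ p * v x ∂μ := by
      apply setIntegral_congr_ae hA0
      filter_upwards [hce] with x hx hxA
      simp only [hτd, if_pos hxA, ENat.toNat_natCast]
      rw [hf, hx, Set.indicator_of_mem hxA]
    have ms : Measurable (μ[fun y => w y ^ (-(1 / (p - 1)))|ℱ n]) :=
      (stronglyMeasurable_condExp.mono (hm n)).measurable
    rw [e1, ← integral_const_mul]
    apply setIntegral_mono_on (hvI.const_mul _).integrableOn _ hA0
    · intro x hx
      have h1 := hAt x hx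
      have := (hv x).le
      gcongr
      exact h1.1.le.trans (le_abs_self _)
    · apply Integrable.bdd_mul (c := (2 * t) ^ p) hvI.integrableOn
      · exact ((continuous_abs.measurable.comp ms).pow_const p).aestronglyMeasurable
      · filter_upwards [ae_restrict_mem hA0] with x hx
        have h1 := hAt x hx
        rw [Real.norm_of_nonneg (by positivity), abs_of_pos (ht.trans h1.1)]
        exact Real.rpow_le_rpow (ht.trans h1.1).le h1.2 (by linarith)
  have bc : (∃ C : ℝ, 0 < C ∧
        ∀ f : Ω → ℝ, Integrable f μ → Integrable (fun x => |f x| ^ p * w x) μ →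
        ∀ lam : ℝ, 0 < lam →
          lam * (∫ x in {x | ENNReal.ofReal lam <
              ⨆ n, ENNReal.ofReal |(μ[f|ℱ n]) x|}, v x ∂μ) ^ (1 / p)
            ≤ C * (∫ x, |f x| ^ p * w x ∂μ) ^ (1 / p)) →
      (∃ C : ℝ, 0 < C ∧ ∀ n : ℕ, ∀ᵐ x ∂μ,
          (μ[v|ℱ n]) x * (μ[fun y => w y ^ (-(1 / (p - 1)))|ℱ n]) x ^ (p - 1) ≤ C) := by
    rintro ⟨C, hC, H⟩
    refine ⟨2 ^ p * C ^ p, by positivity, fun n => ?_⟩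
    refine aux_toC (hm n) σpos hσI hvI hv hp ?_
    intro t ht A hA hAt
    have hA0 := hm n _ hA
    set f : Ω → ℝ := A.indicator (fun y => w y ^ (-(1 / (p - 1)))) with hf
    have hfI : Integrable f μ := hσI.indicator hA0
    have h := H f hfI (by rw [aux_ind hw hp A]; exact hfI) t ht
    rw [aux_ind hw hp A, integral_indicator hA0, aux_pow hp ht.le hC.le
      (integral_nonneg fun x => (hv x).le) (integral_nonneg fun x => (σpos x).le)] at h
    refine le_trans ?_ h
    gcongr 1
    apply setIntegral_mono_set hvI.integrableOn (Eventually.of_forall fun x => (hv x).le)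
    filter_upwards [condExp_indicator (m := ℱ n) hσI hA] with x hx hxA
    have hxA' : x ∈ A := hxA
    show ENNReal.ofReal t < ⨆ n, ENNReal.ofReal |(μ[f|ℱ n]) x|
    refine lt_of_lt_of_le ?_ (le_iSup _ n)
    rw [hf, hx, Set.indicator_of_mem hxA']
    have h1 := hAt x hxA'
    rw [ENNReal.ofReal_lt_ofReal_iff (abs_pos.mpr (ht.trans h1.1).ne')]
    exact h1.1.trans_le (le_abs_self _)
  have ca : (∃ C : ℝ, 0 < C ∧ ∀ n : ℕ, ∀ᵐ x ∂μ,
          (μ[v|ℱ n]) x * (μ[fun y => w y ^ (-(1 / (p - 1)))|ℱ n]) x ^ (p - 1) ≤ C) →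
      (∃ C : ℝ, 0 < C ∧
        ∀ τ : Ω → ℕ∞, (∀ n : ℕ, MeasurableSet[ℱ n] {x | τ x ≤ (n : ℕ∞)}) →
        ∀ f : Ω → ℝ, Integrable f μ → Integrable (fun x => |f x| ^ p * w x) μ →
          (∫ x in {x | τ x ≠ ⊤}, |(μ[f|ℱ (τ x).toNat]) x| ^ p * v x ∂μ) ^ (1 / p)
            ≤ C * (∫ x, |f x| ^ p * w x ∂μ) ^ (1 / p)) := by
    rintro ⟨C, hC, H⟩
    refine ⟨C ^ (1 / p), by positivity, ?_⟩
    intro τ hτ f hf hfw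
    have h := aux_stop ℱ hw hv hp hvI hσI H τ hτ hf hfw
    have gn : ∀ x, 0 ≤ |(μ[f|ℱ (τ x).toNat]) x| ^ p * v x :=
      fun x => by have := hv x; positivity
    have hI : 0 ≤ ∫ x, |f x| ^ p * w x ∂μ := integral_nonneg (fwn f)
    rw [← Real.mul_rpow hC.le hI]
    apply Real.rpow_le_rpow (integral_nonneg gn) _ (by positivity)
    by_cases hint : IntegrableOn (fun x => |(μ[f|ℱ (τ x).toNat]) x| ^ p * v x) {x | τ x ≠ ⊤} μ
    · rw [← ofReal_integral_eq_lintegral_ofReal hint (Eventually.of_forall gn),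
        ← ENNReal.ofReal_mul hC.le, ENNReal.ofReal_le_ofReal_iff (by positivity)] at h
      exact h
    · rw [integral_undef hint]
      positivity
  have cb : (∃ C : ℝ, 0 < C ∧ ∀ n : ℕ, ∀ᵐ x ∂μ,
          (μ[v|ℱ n]) x * (μ[fun y => w y ^ (-(1 / (p - 1)))|ℱ n]) x ^ (p - 1) ≤ C) →
      (∃ C : ℝ, 0 < C ∧
        ∀ f : Ω → ℝ, Integrable f μ → Integrable (fun x => |f x| ^ p * w x) μ →
        ∀ lam : ℝ, 0 < lam →
          lam * (∫ x in {x | ENNReal.ofReal lam <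
              ⨆ n, ENNReal.ofReal |(μ[f|ℱ n]) x|}, v x ∂μ) ^ (1 / p)
            ≤ C * (∫ x, |f x| ^ p * w x ∂μ) ^ (1 / p)) := by
    rintro ⟨C, hC, H⟩
    refine ⟨C ^ (1 / p), by positivity, ?_⟩
    intro f hf hfw lam hlam
    classical
    set P : Ω → ℕ → Prop := fun x n => lam < |(μ[f|ℱ n]) x| with hP
    set τ : Ω → ℕ∞ := fun x => if h : ∃ n, P x n then ((Nat.find h : ℕ) : ℕ∞) else ⊤ with hτd
    have hset : {x | ENNReal.ofReal lam < ⨆ n, ENNReal.ofReal |(μ[f|ℱ n]) x|} =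
        {x | τ x ≠ ⊤} := by
      ext x
      have e : (ENNReal.ofReal lam < ⨆ n, ENNReal.ofReal |(μ[f|ℱ n]) x|) ↔ ∃ n, P x n := by
        rw [lt_iSup_iff]
        refine exists_congr fun n => ?_
        rw [ENNReal.ofReal_lt_ofReal_iff']
        exact ⟨fun h => h.1, fun h => ⟨h, hlam.trans h⟩⟩
      simp only [Set.mem_ofPred_eq, e, hτd]
      by_cases h : ∃ n, P x n <;> simp [h]
    have hτ : ∀ k : ℕ, MeasurableSet[ℱ k] {x | τ x ≤ (k : ℕ∞)} := by
      intro k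
      have : {x | τ x ≤ (k : ℕ∞)} = ⋃ j : ℕ, ⋃ _ : j ≤ k, {x | lam < |(μ[f|ℱ j]) x|} := by
        ext x
        simp only [Set.mem_ofPred_eq, Set.mem_iUnion, hτd]
        by_cases h : ∃ n, P x n
        · rw [dif_pos h, Nat.cast_le, Nat.find_le_iff]
          simp [hP]
        · rw [dif_neg h]
          simp only [top_le_iff, ENat.natCast_ne_top, false_iff]
          rintro ⟨j, _, hj⟩
          exact h ⟨j, hj⟩
      rw [this]
      refine MeasurableSet.iUnion fun j => MeasurableSet.iUnion fun hj => ?_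
      have mj : Measurable[ℱ j] (μ[f|ℱ j]) := stronglyMeasurable_condExp.measurable
      exact ℱ.mono hj _ (measurableSet_lt measurable_const (continuous_abs.measurable.comp mj))
    have hmeas : MeasurableSet {x | τ x ≠ ⊤} := by
      have : {x | τ x ≠ ⊤} = ⋃ k : ℕ, {x | τ x ≤ (k : ℕ∞)} := by
        ext x
        simp only [Set.mem_ofPred_eq, Set.mem_iUnion]
        constructor
        · intro h
          obtain ⟨n, hn⟩ := ENat.ne_top_iff_exists.mp h
          exact ⟨n, hn.symm.le⟩
        · rintro ⟨k, hk⟩ h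
          rw [h] at hk
          simp at hk
      rw [this]
      exact MeasurableSet.iUnion fun k => hm k _ (hτ k)
    have hI : 0 ≤ ∫ x, |f x| ^ p * w x ∂μ := integral_nonneg (fwn f)
    have hp0 : 0 < p := by linarith
    rw [hset, aux_pow hp hlam.le (by positivity) (integral_nonneg fun x => (hv x).le) hI,
      ← Real.rpow_mul hC.le, one_div, inv_mul_cancel₀ hp0.ne', Real.rpow_one]
    have h := aux_stop ℱ hw hv hp hvI hσI H τ hτ hf hfw
    rw [← integral_const_mul, ← ENNReal.ofReal_le_ofReal_iff (by positivity),
      ENNReal.ofReal_mul hC.le]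
    refine le_trans ?_ h
    rw [ofReal_integral_eq_lintegral_ofReal (hvI.const_mul _).integrableOn
      (Eventually.of_forall fun x => by have := hv x; simp only [Pi.zero_apply]; positivity)]
    refine setLIntegral_mono' hmeas fun x hx => ?_
    apply ENNReal.ofReal_le_ofReal
    have hx' : ∃ n, P x n := by
      by_contra hcon
      apply hx
      simp only [hτd, dif_neg hcon]
    have hτx : (τ x).toNat = Nat.find hx' := by
      simp only [hτd, dif_pos hx', ENat.toNat_natCast]
    rw [hτx]
    have h1 : lam < |(μ[f|ℱ (Nat.find hx')]) x| := Nat.find_spec hx'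
    have := (hv x).le
    gcongr
  exact ⟨⟨fun h => cb (ac h), fun h => ca (bc h)⟩, ⟨ac, ca⟩⟩

end
end

section
/- Let v, ω₁, ω₂ be weights, 1 < p₁, p₂ < ∞, 1/p = 1/p₁ + 1/p₂, and suppose (ω₁, ω₂) ∈ RH(p₁, p₂). Then the uniform bound (∫_Ω |E_n(f) E_n(g)|^p v dμ)^{1/p} ≤ C‖f‖_{L^{p₁}(ω₁)}‖g‖_{L^{p₂}(ω₂)} for all n and all f ∈ L^{p₁}(ω₁), g ∈ L^{p₂}(ω₂) holds if and only if (v, ω₁, ω₂) satisfies the bilinear A_{p⃗} condition. -/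
open MeasureTheory Filter ENNReal

noncomputable section

theorem aux_opt {θ A B c : ℝ} (hA : 0 ≤ A) (hB : 0 ≤ B) (h0 : 0 < θ) (h1 : θ < 1)
    (h : ∀ q : ℚ, c ≤ θ * Real.exp ((1 - θ) * q) * A + (1 - θ) * Real.exp (-θ * q) * B) :
    c ≤ A ^ θ * B ^ (1 - θ) := by
  have hr : ∀ y : ℝ, c ≤ θ * Real.exp ((1 - θ) * y) * A + (1 - θ) * Real.exp (-θ * y) * B := by
    intro y
    refine Rat.denseRange_cast.induction_on (p := fun y : ℝ =>
      c ≤ θ * Real.exp ((1 - θ) * y) * A + (1 - θ) * Real.exp (-θ * y) * B) y ?_ h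
    exact isClosed_le continuous_const (by fun_prop)
  have he : ∀ ε : ℝ, 0 < ε → c ≤ (A + ε) ^ θ * (B + ε) ^ (1 - θ) := by
    intro ε hε
    have hA' : 0 < A + ε := by linarith
    have hB' : 0 < B + ε := by linarith
    have h2 := hr (Real.log (B + ε) - Real.log (A + ε))
    rw [Real.rpow_def_of_pos hA', Real.rpow_def_of_pos hB', ← Real.exp_add]
    set α := Real.log (A + ε) with hα
    set β := Real.log (B + ε) with hβ
    have e1 : A + ε = Real.exp α := (Real.exp_log hA').symm
    have e2 : B + ε = Real.exp β := (Real.exp_log hB').symm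
    have i1 : θ * Real.exp ((1 - θ) * (β - α)) * A ≤ θ * Real.exp ((1 - θ) * (β - α)) * Real.exp α := by
      rw [← e1]; exact mul_le_mul_of_nonneg_left (by linarith) (by positivity)
    have i2 : (1 - θ) * Real.exp (-θ * (β - α)) * B ≤ (1 - θ) * Real.exp (-θ * (β - α)) * Real.exp β := by
      rw [← e2]; exact mul_le_mul_of_nonneg_left (by linarith)
        (mul_nonneg (by linarith) (Real.exp_pos _).le)
    have j1 : θ * Real.exp ((1 - θ) * (β - α)) * Real.exp α = θ * Real.exp (α * θ + β * (1 - θ)) := by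
      rw [mul_assoc, ← Real.exp_add]; congr 2; ring
    have j2 : (1 - θ) * Real.exp (-θ * (β - α)) * Real.exp β
        = (1 - θ) * Real.exp (α * θ + β * (1 - θ)) := by
      rw [mul_assoc, ← Real.exp_add]; congr 2; ring
    nlinarith
  have hc : Continuous (fun ε : ℝ => (A + ε) ^ θ * (B + ε) ^ (1 - θ)) := by
    refine Continuous.mul ?_ ?_
    · exact Continuous.rpow_const (by fun_prop) (fun _ => Or.inr h0.le)
    · exact Continuous.rpow_const (by fun_prop) (fun _ => Or.inr (by linarith))
  have ht : Tendsto (fun ε : ℝ => (A + ε) ^ θ * (B + ε) ^ (1 - θ)) (nhdsWithin 0 (Set.Ioi 0))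
      (nhds (A ^ θ * B ^ (1 - θ))) := by
    have := hc.tendsto 0
    simp only [add_zero] at this
    exact this.mono_left nhdsWithin_le_nhds
  refine ge_of_tendsto ht ?_
  filter_upwards [self_mem_nhdsWithin] with ε hε using he ε hε

theorem aux_young_s10 {θ a b : ℝ} (ha : 0 ≤ a) (hb : 0 ≤ b) (h0 : 0 < θ) (h1 : θ < 1) (y : ℝ) :
    a ^ θ * b ^ (1 - θ) ≤ θ * Real.exp ((1 - θ) * y) * a + (1 - θ) * Real.exp (-θ * y) * b := by
  have := Real.geom_mean_le_arith_mean2_weighted (w₁ := θ) (w₂ := 1 - θ)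
    (p₁ := Real.exp ((1 - θ) * y) * a) (p₂ := Real.exp (-θ * y) * b) h0.le (by linarith)
    (by positivity) (by positivity) (by ring)
  rw [Real.mul_rpow (by positivity) ha, Real.mul_rpow (by positivity) hb, ← Real.exp_mul,
    ← Real.exp_mul] at this
  have e : Real.exp ((1 - θ) * y * θ) * Real.exp (-θ * y * (1 - θ)) = 1 := by
    rw [← Real.exp_add]; simp; ring
  calc a ^ θ * b ^ (1 - θ)
      = (Real.exp ((1 - θ) * y * θ) * Real.exp (-θ * y * (1 - θ))) * (a ^ θ * b ^ (1 - θ)) := by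
        rw [e, one_mul]
    _ ≤ _ := by linarith

theorem aux_int {Ω : Type*} {m0 : MeasurableSpace Ω} {μ : Measure Ω}
    {θ : ℝ} {a b : Ω → ℝ} (ha : 0 ≤ᵐ[μ] a) (hb : 0 ≤ᵐ[μ] b) (h0 : 0 < θ) (h1 : θ < 1)
    (haI : Integrable a μ) (hbI : Integrable b μ) :
    Integrable (fun x => a x ^ θ * b x ^ (1 - θ)) μ := by
  refine Integrable.mono' ((haI.const_mul (θ * Real.exp ((1 - θ) * 0))).add
    (hbI.const_mul ((1 - θ) * Real.exp (-θ * 0)))) ?_ ?_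
  · exact ((haI.aestronglyMeasurable.aemeasurable.pow_const θ).mul
      (hbI.aestronglyMeasurable.aemeasurable.pow_const (1 - θ))).aestronglyMeasurable
  · filter_upwards [ha, hb] with x hx hy
    have hx : 0 ≤ a x := hx
    have hy : 0 ≤ b x := hy
    rw [Real.norm_of_nonneg (by positivity)]
    exact aux_young_s10 hx hy h0 h1 0

theorem aux_cond {Ω : Type*} {m m0 : MeasurableSpace Ω} {μ : Measure Ω} [IsProbabilityMeasure μ]
    (hm : m ≤ m0)
    {θ : ℝ} {a b : Ω → ℝ} (ha : 0 ≤ᵐ[μ] a) (hb : 0 ≤ᵐ[μ] b) (h0 : 0 < θ) (h1 : θ < 1)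
    (haI : Integrable a μ) (hbI : Integrable b μ) :
    ∀ᵐ x ∂μ, (μ[fun x => a x ^ θ * b x ^ (1 - θ)|m]) x
      ≤ (μ[a|m]) x ^ θ * (μ[b|m]) x ^ (1 - θ) := by
  have key : ∀ q : ℚ, ∀ᵐ x ∂μ, (μ[fun x => a x ^ θ * b x ^ (1 - θ)|m]) x ≤
      θ * Real.exp ((1 - θ) * q) * (μ[a|m]) x + (1 - θ) * Real.exp (-θ * q) * (μ[b|m]) x := by
    intro q
    have i1 := haI.smul (θ * Real.exp ((1 - θ) * q))
    have i2 := hbI.smul ((1 - θ) * Real.exp (-θ * q))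
    have h := condExp_mono (m := m) (aux_int ha hb h0 h1 haI hbI) (i1.add i2) (by
      filter_upwards [ha, hb] with x hx hy
      exact aux_young_s10 hx hy h0 h1 q)
    filter_upwards [h, condExp_add i1 i2 m,
      condExp_smul (μ := μ) (θ * Real.exp ((1 - θ) * q)) a m,
      condExp_smul (μ := μ) ((1 - θ) * Real.exp (-θ * q)) b m] with x g1 g2 g3 g4
    rw [g2, Pi.add_apply, g3, g4] at g1
    simpa using g1
  filter_upwards [ae_all_iff.2 key, condExp_nonneg (m := m) ha, condExp_nonneg (m := m) hb]
    with x hx hA hB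
  exact aux_opt hA hB h0 h1 hx

theorem aux_holder_s10 {Ω : Type*} {m0 : MeasurableSpace Ω} {μ : Measure Ω} [IsProbabilityMeasure μ]
    {θ : ℝ} {a b : Ω → ℝ} (ha : 0 ≤ᵐ[μ] a) (hb : 0 ≤ᵐ[μ] b) (h0 : 0 < θ) (h1 : θ < 1)
    (haI : Integrable a μ) (hbI : Integrable b μ) :
    ∫ x, a x ^ θ * b x ^ (1 - θ) ∂μ ≤ (∫ x, a x ∂μ) ^ θ * (∫ x, b x ∂μ) ^ (1 - θ) := by
  have h := aux_cond (bot_le : ⊥ ≤ m0) ha hb h0 h1 haI hbI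
  simp only [condExp_bot] at h
  obtain ⟨x, hx⟩ := h.exists
  exact hx

theorem aux_pull {Ω : Type*} {m m0 : MeasurableSpace Ω} {μ : Measure Ω} [IsProbabilityMeasure μ]
    (hm : m ≤ m0) {H v : Ω → ℝ} (hH : StronglyMeasurable[m] H) (hv : Integrable v μ)
    (hHv : Integrable (H * v) μ) :
    Integrable (H * μ[v|m]) μ ∧ ∫ x, H x * v x ∂μ = ∫ x, H x * (μ[v|m]) x ∂μ := by
  have h := condExp_mul_of_stronglyMeasurable_left hH hHv hv
  refine ⟨(integrable_condExp (m := m) (f := H * v)).congr h, ?_⟩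
  calc _ = ∫ x, (H * v) x ∂μ := rfl
    _ = ∫ x, (μ[H * v|m]) x ∂μ := (integral_condExp hm).symm
    _ = _ := integral_congr_ae h

/-- pointwise bound of conditional expectation by weighted Hölder. -/
theorem aux_E {Ω : Type*} {m m0 : MeasurableSpace Ω} {μ : Measure Ω} [IsProbabilityMeasure μ]
    (hm : m ≤ m0) {q : ℝ} (hq : 1 < q) {f ω : Ω → ℝ} (hω : ∀ x, 0 < ω x)
    (hσ : Integrable (fun x => ω x ^ (-(1 / (q - 1)))) μ) (hf : Integrable f μ)
    (hfω : Integrable (fun x => |f x| ^ q * ω x) μ) :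
    ∀ᵐ x ∂μ, |(μ[f|m]) x| ≤ (μ[fun x => |f x| ^ q * ω x|m]) x ^ (1 / q)
      * (μ[fun y => ω y ^ (-(1 / (q - 1)))|m]) x ^ ((q - 1) / q) := by
  have hq0 : 0 < q := by linarith
  have hq1 : q - 1 ≠ 0 := by linarith
  have e : (q - 1) / q = 1 - 1 / q := by field_simp
  have h := aux_cond hm (μ := μ) (θ := 1 / q)
    (ae_of_all _ fun x => mul_nonneg (Real.rpow_nonneg (abs_nonneg (f x)) q) (hω x).le)
    (ae_of_all _ fun x => Real.rpow_nonneg (hω x).le (-(1 / (q - 1)))) (by positivity)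
    (by rw [div_lt_one hq0]; exact hq) hfω hσ
  have e2 : (fun x => (|f x| ^ q * ω x) ^ (1 / q) * (ω x ^ (-(1 / (q - 1)))) ^ (1 - 1 / q))
      = fun x => |f x| := by
    funext x
    rw [Real.mul_rpow (by positivity) (hω x).le, ← Real.rpow_mul (abs_nonneg _),
      ← Real.rpow_mul (hω x).le, mul_assoc, ← Real.rpow_add (hω x), mul_one_div_cancel hq0.ne',
      Real.rpow_one]
    have : 1 / q + -(1 / (q - 1)) * (1 - 1 / q) = 0 := by field_simp; ring
    rw [this]; simp
  rw [e2] at h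
  have u1 := condExp_mono (m := m) hf hf.abs (ae_of_all _ fun x => le_abs_self (f x))
  have u2 := condExp_mono (m := m) hf.neg hf.abs (ae_of_all _ fun x => neg_le_abs (f x))
  filter_upwards [h, u1, u2, condExp_neg (μ := μ) f m] with x g1 g2 g3 g4
  rw [e]
  rw [g4] at g3
  refine le_trans (abs_le'.2 ⟨g2, g3⟩) g1

theorem aux_mL {Ω : Type*} {m : MeasurableSpace Ω} {a b : Ω → ℝ} (p : ℝ)
    (ha : StronglyMeasurable a) (hb : StronglyMeasurable b) :
    Measurable (fun x => |a x * b x| ^ p) :=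
  (ha.measurable.mul hb.measurable).norm.pow_const p

theorem aux_mR {Ω : Type*} {m : MeasurableSpace Ω} {a b : Ω → ℝ} (K p q : ℝ)
    (ha : StronglyMeasurable a) (hb : StronglyMeasurable b) :
    Measurable (fun x => K * (a x ^ p * b x ^ q)) :=
  ((ha.measurable.pow_const _).mul (hb.measurable.pow_const _)).const_mul K

theorem aux_mD {Ω : Type*} {m : MeasurableSpace Ω} {a b L R : Ω → ℝ} (k : ℝ)
    (ha : StronglyMeasurable a) (hb : StronglyMeasurable b) (hL : Measurable L)
    (hR : Measurable R) :
    MeasurableSet ({x | |a x * b x| ≤ k} ∩ {x | R x < L x}) :=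
  (measurableSet_le (ha.measurable.mul hb.measurable).norm measurable_const).inter
    (measurableSet_lt hR hL)

theorem stmt_10
    {Ω : Type*} {m0 : MeasurableSpace Ω} {μ : Measure Ω} [IsProbabilityMeasure μ]
    (ℱ : Filtration ℕ m0)
    (v ω₁ ω₂ : Ω → ℝ)
    (hv : ∀ x, 0 < v x) (hω₁ : ∀ x, 0 < ω₁ x) (hω₂ : ∀ x, 0 < ω₂ x)
    (hvI : Integrable v μ) (hω₁I : Integrable ω₁ μ) (hω₂I : Integrable ω₂ μ)
    (p p₁ p₂ C₀ : ℝ) (hp₁ : 1 < p₁) (hp₂ : 1 < p₂)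
    (hp : 1 / p = 1 / p₁ + 1 / p₂) (hC₀ : 0 < C₀)
    (hσ₁I : Integrable (fun x => ω₁ x ^ (-(1 / (p₁ - 1)))) μ)
    (hσ₂I : Integrable (fun x => ω₂ x ^ (-(1 / (p₂ - 1)))) μ)
    (hRH : ∀ τ : Ω → ℕ∞, (∀ n : ℕ, MeasurableSet[ℱ n] {x | τ x ≤ (n : ℕ∞)}) →
      (∫ x in {x | τ x ≠ ⊤}, ω₁ x ^ (-(1 / (p₁ - 1))) ∂μ) ^ (p / p₁)
          * (∫ x in {x | τ x ≠ ⊤}, ω₂ x ^ (-(1 / (p₂ - 1))) ∂μ) ^ (p / p₂)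
        ≤ C₀ * ∫ x in {x | τ x ≠ ⊤},
            (ω₁ x ^ (-(1 / (p₁ - 1)))) ^ (p / p₁)
              * (ω₂ x ^ (-(1 / (p₂ - 1)))) ^ (p / p₂) ∂μ) :
    (∃ C : ℝ, 0 < C ∧
      ∀ n : ℕ, ∀ f g : Ω → ℝ, Integrable f μ →
        Integrable (fun x => |f x| ^ p₁ * ω₁ x) μ →
        Integrable g μ →
        Integrable (fun x => |g x| ^ p₂ * ω₂ x) μ →
        (∫ x, |(μ[f|ℱ n]) x * (μ[g|ℱ n]) x| ^ p * v x ∂μ) ^ (1 / p)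
          ≤ C * (∫ x, |f x| ^ p₁ * ω₁ x ∂μ) ^ (1 / p₁)
              * (∫ x, |g x| ^ p₂ * ω₂ x ∂μ) ^ (1 / p₂))
    ↔ (∃ C : ℝ, 0 < C ∧ ∀ n : ℕ, ∀ᵐ x ∂μ,
        (μ[v|ℱ n]) x ^ (1 / p)
          * (μ[fun y => ω₁ y ^ (-(1 / (p₁ - 1)))|ℱ n]) x ^ ((p₁ - 1) / p₁)
          * (μ[fun y => ω₂ y ^ (-(1 / (p₂ - 1)))|ℱ n]) x ^ ((p₂ - 1) / p₂) ≤ C) := by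
  have hp10 : 0 < p₁ := by linarith
  have hp20 : 0 < p₂ := by linarith
  have hp0 : 0 < p := by
    have : 0 < 1 / p := by rw [hp]; positivity
    exact one_div_pos.1 this
  have hθ : p / p₂ = 1 - p / p₁ := by
    have : p * (1 / p) = 1 := by field_simp
    rw [hp] at this
    have h2 : p * (1 / p₁ + 1 / p₂) = p / p₁ + p / p₂ := by ring
    linarith
  have hθ0 : 0 < p / p₁ := by positivity
  have hθ1 : p / p₁ < 1 := by
    have : 0 < p / p₂ := by positivity
    linarith
  have hσ₁0 : ∀ x, 0 < ω₁ x ^ (-(1 / (p₁ - 1))) := fun x => Real.rpow_pos_of_pos (hω₁ x) _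
  have hσ₂0 : ∀ x, 0 < ω₂ x ^ (-(1 / (p₂ - 1))) := fun x => Real.rpow_pos_of_pos (hω₂ x) _
  constructor
  · rintro ⟨C, hC, hb⟩
    have hpw : ∀ (q : ℝ), 1 < q → ∀ (ω : Ω → ℝ), (∀ x, 0 < ω x) → ∀ (D : Set Ω),
        (fun x => |D.indicator (fun y => ω y ^ (-(1 / (q - 1)))) x| ^ q * ω x)
          = D.indicator (fun y => ω y ^ (-(1 / (q - 1)))) := by
      intro q hq ω hω D
      have hq1 : q - 1 ≠ 0 := by linarith
      funext x
      by_cases hx : x ∈ D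
      · simp only [Set.indicator_of_mem hx]
        rw [abs_of_pos (Real.rpow_pos_of_pos (hω x) _), ← Real.rpow_mul (hω x).le]
        nth_rewrite 2 [← Real.rpow_one (ω x)]
        rw [← Real.rpow_add (hω x)]
        congr 1; field_simp; ring
      · simp only [Set.indicator_of_notMem hx]
        rw [abs_zero, Real.zero_rpow (by linarith), zero_mul]
    generalize hσ₁ : (fun y => ω₁ y ^ (-(1 / (p₁ - 1)))) = σ₁ at *
    generalize hσ₂ : (fun y => ω₂ y ^ (-(1 / (p₂ - 1)))) = σ₂ at *
    have hσ₁' : ∀ y, ω₁ y ^ (-(1 / (p₁ - 1))) = σ₁ y := fun y => congrFun hσ₁ y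
    have hσ₂' : ∀ y, ω₂ y ^ (-(1 / (p₂ - 1))) = σ₂ y := fun y => congrFun hσ₂ y
    simp only [hσ₁', hσ₂'] at hRH hσ₁0 hσ₂0
    set K := C ^ p * C₀ with hK
    have hK0 : 0 < K := by positivity
    refine ⟨K ^ (1 / p), by positivity, fun n => ?_⟩
    set s₁ := μ[σ₁|ℱ n] with hs₁
    set s₂ := μ[σ₂|ℱ n] with hs₂
    set w := μ[v|ℱ n] with hw
    have ms₁ : StronglyMeasurable[ℱ n] s₁ := stronglyMeasurable_condExp
    have ms₂ : StronglyMeasurable[ℱ n] s₂ := stronglyMeasurable_condExp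
    have mw : StronglyMeasurable[ℱ n] w := stronglyMeasurable_condExp
    have ps₁ : 0 ≤ᵐ[μ] s₁ := condExp_nonneg (ae_of_all _ fun x => (hσ₁0 x).le)
    have ps₂ : 0 ≤ᵐ[μ] s₂ := condExp_nonneg (ae_of_all _ fun x => (hσ₂0 x).le)
    have pw : 0 ≤ᵐ[μ] w := condExp_nonneg (ae_of_all _ fun x => (hv x).le)
    have is₁ : Integrable s₁ μ := integrable_condExp
    have is₂ : Integrable s₂ μ := integrable_condExp
    have mL0 : Measurable[ℱ n] (fun x => |s₁ x * s₂ x| ^ p) :=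
      aux_mL p ms₁ ms₂
    have mL : Measurable[ℱ n] (fun x => |s₁ x * s₂ x| ^ p * w x) := mL0.mul mw.measurable
    have mR : Measurable[ℱ n] (fun x => K * (s₁ x ^ (p / p₁) * s₂ x ^ (1 - p / p₁))) :=
      aux_mR K _ _ ms₁ ms₂
    have iR0 := aux_int ps₁ ps₂ hθ0 hθ1 is₁ is₂
    have iR := iR0.const_mul K
    have main : ∀ k : ℕ, ∀ᵐ x ∂μ, |s₁ x * s₂ x| ≤ k →
        |s₁ x * s₂ x| ^ p * w x ≤ K * (s₁ x ^ (p / p₁) * s₂ x ^ (1 - p / p₁)) := by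
      intro k
      set D : Set Ω := {x | |s₁ x * s₂ x| ≤ k} ∩
        {x | K * (s₁ x ^ (p / p₁) * s₂ x ^ (1 - p / p₁)) < |s₁ x * s₂ x| ^ p * w x} with hD
      have mD : MeasurableSet[ℱ n] D :=
        aux_mD k ms₁ ms₂ mL mR
      have mD0 : MeasurableSet D := ℱ.le n _ mD
      -- H
      set H : Ω → ℝ := D.indicator (fun x => |s₁ x * s₂ x| ^ p) with hH
      have mH : StronglyMeasurable[ℱ n] H := (mL0.indicator mD).stronglyMeasurable
      have iH : Integrable (H * v) μ := by
        refine hvI.bdd_mul (c := (k : ℝ) ^ p) (mH.mono (ℱ.le n)).aestronglyMeasurable ?_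
        refine ae_of_all _ fun x => ?_
        by_cases hx : x ∈ D
        · rw [hH, Set.indicator_of_mem hx, Real.norm_of_nonneg (by positivity)]
          exact Real.rpow_le_rpow (abs_nonneg _) hx.1 hp0.le
        · rw [hH, Set.indicator_of_notMem hx]; simp; positivity
      obtain ⟨iHw, eHw⟩ := aux_pull (ℱ.le n) mH hvI iH
      have hHw : (fun x => H x * w x) = D.indicator (fun x => |s₁ x * s₂ x| ^ p * w x) := by
        funext x
        by_cases hx : x ∈ D
        · simp [hH, hx]
        · simp [hH, hx]
      have h1 := hb n (D.indicator σ₁) (D.indicator σ₂) (hσ₁I.indicator mD0)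
        (by have := hpw p₁ hp₁ ω₁ hω₁ D
            rw [hσ₁] at this; rw [this]; exact hσ₁I.indicator mD0) (hσ₂I.indicator mD0)
        (by have := hpw p₂ hp₂ ω₂ hω₂ D
            rw [hσ₂] at this; rw [this]; exact hσ₂I.indicator mD0)
      have t1 := hpw p₁ hp₁ ω₁ hω₁ D
      have t2 := hpw p₂ hp₂ ω₂ hω₂ D
      rw [hσ₁] at t1; rw [hσ₂] at t2
      rw [t1, t2, integral_indicator mD0, integral_indicator mD0] at h1
      have t3 : ∫ x, |(μ[D.indicator σ₁|ℱ n]) x * (μ[D.indicator σ₂|ℱ n]) x| ^ p * v x ∂μ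
          = ∫ x in D, |s₁ x * s₂ x| ^ p * w x ∂μ := by
        rw [← integral_indicator mD0, ← hHw, ← eHw]
        apply integral_congr_ae
        filter_upwards [condExp_indicator hσ₁I mD, condExp_indicator hσ₂I mD] with x g1 g2
        rw [g1, g2]
        by_cases hx : x ∈ D
        · simp [hH, hx, hs₁, hs₂]
        · simp [hH, hx, hp0.ne']
      rw [t3] at h1
      have hX0 : 0 ≤ ∫ x in D, |s₁ x * s₂ x| ^ p * w x ∂μ := by
        rw [← t3]; exact integral_nonneg fun x => mul_nonneg (by positivity) (hv x).le
      have hY1 : 0 ≤ ∫ x in D, σ₁ x ∂μ := integral_nonneg fun x => (hσ₁0 x).le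
      have hY2 : 0 ≤ ∫ x in D, σ₂ x ∂μ := integral_nonneg fun x => (hσ₂0 x).le
      have h2 := Real.rpow_le_rpow (by positivity) h1 hp0.le
      rw [← Real.rpow_mul hX0, one_div_mul_cancel hp0.ne', Real.rpow_one,
        Real.mul_rpow (by positivity) (by positivity), Real.mul_rpow (by positivity) (by positivity),
        ← Real.rpow_mul hY1, ← Real.rpow_mul hY2, one_div_mul_eq_div, one_div_mul_eq_div] at h2
      -- RH
      classical
      have h3 := hRH (fun x => if x ∈ D then (n : ℕ∞) else ⊤) (by
        intro j
        by_cases hj : n ≤ j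
        · have : {x | (if x ∈ D then (n : ℕ∞) else ⊤) ≤ (j : ℕ∞)} = D := by
            ext x; by_cases hx : x ∈ D <;> simp [hx, hj]
          rw [this]; exact ℱ.mono hj _ mD
        · have : {x | (if x ∈ D then (n : ℕ∞) else ⊤) ≤ (j : ℕ∞)} = ∅ := by
            ext x; by_cases hx : x ∈ D <;> simp [hx]; omega
          rw [this]; exact @MeasurableSet.empty _ (ℱ j))
      have t4 : {x | (if x ∈ D then (n : ℕ∞) else ⊤) ≠ ⊤} = D := by
        ext x; by_cases hx : x ∈ D <;> simp [hx]
      rw [t4] at h3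
      -- conditional Holder
      have h4 : ∫ x in D, σ₁ x ^ (p / p₁) * σ₂ x ^ (1 - p / p₁) ∂μ
          ≤ ∫ x in D, s₁ x ^ (p / p₁) * s₂ x ^ (1 - p / p₁) ∂μ := by
        rw [← setIntegral_condExp (ℱ.le n) (aux_int (ae_of_all _ fun x => (hσ₁0 x).le)
          (ae_of_all _ fun x => (hσ₂0 x).le) hθ0 hθ1 hσ₁I hσ₂I) mD]
        refine setIntegral_mono_ae integrable_condExp.integrableOn iR0.integrableOn ?_
        exact aux_cond (ℱ.le n) (ae_of_all _ fun x => (hσ₁0 x).le)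
          (ae_of_all _ fun x => (hσ₂0 x).le) hθ0 hθ1 hσ₁I hσ₂I
      rw [hθ] at h2 h3
      have h5 : ∫ x in D, |s₁ x * s₂ x| ^ p * w x ∂μ
          ≤ ∫ x in D, K * (s₁ x ^ (p / p₁) * s₂ x ^ (1 - p / p₁)) ∂μ := by
        rw [integral_const_mul]
        calc _ ≤ _ := h2
          _ = C ^ p * ((∫ x in D, σ₁ x ∂μ) ^ (p / p₁) * (∫ x in D, σ₂ x ∂μ) ^ (1 - p / p₁)) := by
            ring
          _ ≤ C ^ p * (C₀ * ∫ x in D, σ₁ x ^ (p / p₁) * σ₂ x ^ (1 - p / p₁) ∂μ) := by gcongr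
          _ ≤ C ^ p * (C₀ * ∫ x in D, s₁ x ^ (p / p₁) * s₂ x ^ (1 - p / p₁) ∂μ) := by gcongr
          _ = _ := by rw [hK]; ring
      have iL : IntegrableOn (fun x => |s₁ x * s₂ x| ^ p * w x) D μ := by
        rw [← integrable_indicator_iff mD0, ← hHw]; exact iHw
      have hD0 : μ D = 0 := by
        by_contra hne
        have : 0 < ∫ x in D, (|s₁ x * s₂ x| ^ p * w x
            - K * (s₁ x ^ (p / p₁) * s₂ x ^ (1 - p / p₁))) ∂μ := by
          rw [setIntegral_pos_iff_support_of_nonneg_ae]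
          · refine lt_of_lt_of_le (pos_iff_ne_zero.2 hne) (measure_mono ?_)
            intro x hx
            exact ⟨(sub_pos.2 hx.2).ne', hx⟩
          · filter_upwards [ae_restrict_mem mD0] with x hx
            exact (sub_pos.2 hx.2).le
          · exact iL.sub iR.integrableOn
        rw [integral_sub iL iR.integrableOn] at this
        linarith
      have : ∀ᵐ x ∂μ, x ∉ D := measure_eq_zero_iff_ae_notMem.1 hD0
      filter_upwards [this] with x hx hk
      by_contra hlt
      exact hx ⟨hk, not_le.1 hlt⟩
    filter_upwards [ae_all_iff.2 main, ps₁, ps₂, pw] with x hx q1 q2 qw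
    obtain ⟨k, hk⟩ := exists_nat_ge |s₁ x * s₂ x|
    have h := hx k hk
    have q1 : 0 ≤ s₁ x := q1
    have q2 : 0 ≤ s₂ x := q2
    have qw : 0 ≤ w x := qw
    rcases q1.eq_or_lt with z | q1'
    · rw [← z, Real.zero_rpow (by apply ne_of_gt; apply div_pos <;> linarith)]; simp; positivity
    rcases q2.eq_or_lt with z | q2'
    · rw [← z, Real.zero_rpow (by apply ne_of_gt; apply div_pos <;> linarith)]; simp; positivity
    have e1 : s₁ x ^ p = (s₁ x ^ ((p₁ - 1) / p₁)) ^ p * s₁ x ^ (p / p₁) := by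
      rw [← Real.rpow_mul q1, ← Real.rpow_add q1']; congr 1; field_simp; ring
    have e2 : s₂ x ^ p = (s₂ x ^ ((p₂ - 1) / p₂)) ^ p * s₂ x ^ (1 - p / p₁) := by
      rw [← hθ, ← Real.rpow_mul q2, ← Real.rpow_add q2']; congr 1; field_simp; ring
    rw [abs_of_nonneg (by positivity), Real.mul_rpow q1 q2, e1, e2] at h
    have hpos : 0 < s₁ x ^ (p / p₁) * s₂ x ^ (1 - p / p₁) := by positivity
    have h' : w x * (s₁ x ^ ((p₁ - 1) / p₁)) ^ p * (s₂ x ^ ((p₂ - 1) / p₂)) ^ p ≤ K := by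
      refine le_of_mul_le_mul_right ?_ hpos
      linarith
    have h'' := Real.rpow_le_rpow (by positivity) h' (one_div_pos.2 hp0).le
    rw [Real.mul_rpow (by positivity) (by positivity), Real.mul_rpow (by positivity) (by positivity),
      ← Real.rpow_mul (Real.rpow_nonneg q1 _), ← Real.rpow_mul (Real.rpow_nonneg q2 _),
      mul_one_div_cancel hp0.ne', Real.rpow_one, Real.rpow_one] at h''
    exact h''
  · rintro ⟨C, hC, hA⟩
    refine ⟨C, hC, fun n f g hf hfω hg hgω => ?_⟩
    have pF : ∀ x, 0 ≤ |f x| ^ p₁ * ω₁ x := fun x => mul_nonneg (by positivity) (hω₁ x).le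
    have pG : ∀ x, 0 ≤ |g x| ^ p₂ * ω₂ x := fun x => mul_nonneg (by positivity) (hω₂ x).le
    have hf1 := aux_E (ℱ.le n) hp₁ hω₁ hσ₁I hf hfω
    have hg1 := aux_E (ℱ.le n) hp₂ hω₂ hσ₂I hg hgω
    have hYF : 0 ≤ ∫ x, |f x| ^ p₁ * ω₁ x ∂μ := integral_nonneg pF
    have hYG : 0 ≤ ∫ x, |g x| ^ p₂ * ω₂ x ∂μ := integral_nonneg pG
    set H : Ω → ℝ := fun x => |(μ[f|ℱ n]) x * (μ[g|ℱ n]) x| ^ p with hH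
    have mH : StronglyMeasurable[ℱ n] H :=
      (aux_mL p (stronglyMeasurable_condExp (μ := μ) (f := f))
        (stronglyMeasurable_condExp (μ := μ) (f := g))).stronglyMeasurable
    change (∫ x, H x * v x ∂μ) ^ (1 / p) ≤ _
    have pv : 0 ≤ᵐ[μ] μ[v|ℱ n] := condExp_nonneg (ae_of_all _ fun x => (hv x).le)
    have pF' : 0 ≤ᵐ[μ] μ[fun x => |f x| ^ p₁ * ω₁ x|ℱ n] := condExp_nonneg (ae_of_all _ pF)
    have pG' : 0 ≤ᵐ[μ] μ[fun x => |g x| ^ p₂ * ω₂ x|ℱ n] := condExp_nonneg (ae_of_all _ pG)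
    have ps₁ : 0 ≤ᵐ[μ] μ[fun y => ω₁ y ^ (-(1 / (p₁ - 1)))|ℱ n] :=
      condExp_nonneg (ae_of_all _ fun x => (hσ₁0 x).le)
    have ps₂ : 0 ≤ᵐ[μ] μ[fun y => ω₂ y ^ (-(1 / (p₂ - 1)))|ℱ n] :=
      condExp_nonneg (ae_of_all _ fun x => (hσ₂0 x).le)
    by_cases hI : Integrable (H * v) μ
    swap
    · have : ∫ x, H x * v x ∂μ = 0 := integral_undef hI
      rw [this, Real.zero_rpow (by positivity)]; positivity
    obtain ⟨iHw, eHw⟩ := aux_pull (ℱ.le n) mH hvI hI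
    have iFG := aux_int pF' pG' hθ0 hθ1 integrable_condExp integrable_condExp
    have hle : ∫ x, H x * v x ∂μ ≤ C ^ p * ((∫ x, |f x| ^ p₁ * ω₁ x ∂μ) ^ (p / p₁) *
        (∫ x, |g x| ^ p₂ * ω₂ x ∂μ) ^ (p / p₂)) := by
      rw [eHw]
      calc _ ≤ ∫ x, C ^ p * ((μ[fun x => |f x| ^ p₁ * ω₁ x|ℱ n]) x ^ (p / p₁) *
            (μ[fun x => |g x| ^ p₂ * ω₂ x|ℱ n]) x ^ (1 - p / p₁)) ∂μ := by
            refine integral_mono_ae iHw (iFG.const_mul _) ?_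
            filter_upwards [hf1, hg1, hA n, pv, pF', pG', ps₁, ps₂] with x a1 a2 a3 a4 a5 a6 a7 a8
            simp only [Pi.zero_apply] at a4 a5 a6 a7 a8
            rw [← hθ]
            simp only [hH, Pi.mul_apply]
            generalize (μ[f|ℱ n]) x = y1 at *
            generalize (μ[g|ℱ n]) x = y2 at *
            generalize (μ[v|ℱ n]) x = w at *
            generalize (μ[fun x => |f x| ^ p₁ * ω₁ x|ℱ n]) x = F at *
            generalize (μ[fun x => |g x| ^ p₂ * ω₂ x|ℱ n]) x = G at *
            generalize (μ[fun y => ω₁ y ^ (-(1 / (p₁ - 1)))|ℱ n]) x = s at *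
            generalize (μ[fun y => ω₂ y ^ (-(1 / (p₂ - 1)))|ℱ n]) x = t at *
            have ew : w = (w ^ (1 / p)) ^ p := by
              rw [← Real.rpow_mul a4, one_div_mul_cancel hp0.ne', Real.rpow_one]
            have eF : F ^ (p / p₁) = (F ^ (1 / p₁)) ^ p := by
              rw [← Real.rpow_mul a5, one_div_mul_eq_div]
            have eG : G ^ (p / p₂) = (G ^ (1 / p₂)) ^ p := by
              rw [← Real.rpow_mul a6, one_div_mul_eq_div]
            rw [eF, eG]
            nth_rewrite 1 [ew]
            rw [← Real.mul_rpow (by positivity) (by positivity),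
              ← Real.mul_rpow (by positivity) (by positivity),
              ← Real.mul_rpow (by positivity) (by positivity)]
            refine Real.rpow_le_rpow (by positivity) ?_ hp0.le
            rw [abs_mul]
            calc |y1| * |y2| * w ^ (1 / p) ≤ (F ^ (1 / p₁) * s ^ ((p₁ - 1) / p₁)) *
                  (G ^ (1 / p₂) * t ^ ((p₂ - 1) / p₂)) * w ^ (1 / p) := by gcongr
              _ = (w ^ (1 / p) * s ^ ((p₁ - 1) / p₁) * t ^ ((p₂ - 1) / p₂)) *
                  (F ^ (1 / p₁) * G ^ (1 / p₂)) := by ring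
              _ ≤ C * (F ^ (1 / p₁) * G ^ (1 / p₂)) := by gcongr
        _ ≤ _ := by
            rw [integral_const_mul, hθ]
            refine mul_le_mul_of_nonneg_left ?_ (by positivity)
            have := aux_holder_s10 pF' pG' hθ0 hθ1 integrable_condExp integrable_condExp
            rwa [integral_condExp (ℱ.le n), integral_condExp (ℱ.le n)] at this
    have hX0 : 0 ≤ ∫ x, H x * v x ∂μ :=
      integral_nonneg fun x => mul_nonneg (Real.rpow_nonneg (abs_nonneg _) _) (hv x).le
    have h2 := Real.rpow_le_rpow hX0 hle (one_div_pos.2 hp0).le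
    rw [Real.mul_rpow (by positivity) (by positivity), Real.mul_rpow (by positivity) (by positivity),
      ← Real.rpow_mul hC.le, ← Real.rpow_mul hYF, ← Real.rpow_mul hYG, mul_one_div_cancel hp0.ne',
      Real.rpow_one, ← mul_assoc] at h2
    have x1 : p / p₁ * (1 / p) = 1 / p₁ := by field_simp
    have x2 : p / p₂ * (1 / p) = 1 / p₂ := by field_simp
    rwa [x1, x2] at h2

end
end

section
/- Let ω₁, ω₂ be weights, 1 < p₁, p₂ < ∞, 1/p = 1/p₁ + 1/p₂, and v = ω₁^{p/p₁} ω₂^{p/p₂}. If the triple (v, ω₁, ω₂) satisfies the bilinear martingale A_{p⃗} condition, then for all f ∈ L^{p₁}(ω₁) and g ∈ L^{p₂}(ω₂), lim_{n→∞} ∫_Ω |E_n(f)E_n(g) - fg|^p v dμ = 0. -/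
open MeasureTheory Filter ENNReal

noncomputable section

theorem gdct {Ω : Type*} {m0 : MeasurableSpace Ω} {μ : Measure Ω}
    (a b : ℕ → Ω → ℝ) (B : Ω → ℝ)
    (ham : ∀ n, AEStronglyMeasurable (a n) μ)
    (hbi : ∀ n, Integrable (b n) μ) (hBi : Integrable B μ)
    (ha0 : ∀ n, ∀ᵐ x ∂μ, 0 ≤ a n x) (hab : ∀ n, ∀ᵐ x ∂μ, a n x ≤ b n x)
    (hB0 : ∀ᵐ x ∂μ, 0 ≤ B x)
    (hal : ∀ᵐ x ∂μ, Tendsto (fun n => a n x) atTop (nhds 0))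
    (hbl : ∀ᵐ x ∂μ, Tendsto (fun n => b n x) atTop (nhds (B x)))
    (hint : Tendsto (fun n => ∫ x, b n x ∂μ) atTop (nhds (∫ x, B x ∂μ))) :
    Tendsto (fun n => ∫ x, a n x ∂μ) atTop (nhds 0) := by
  have hai : ∀ n, Integrable (a n) μ := fun n => by
    refine (hbi n).mono' (ham n) ?_
    filter_upwards [ha0 n, hab n] with x h1 h2
    rwa [Real.norm_eq_abs, abs_of_nonneg h1]
  have h1 : Tendsto (fun n => ∫ x, min (a n x) (B x) ∂μ) atTop (nhds (∫ x, (0:ℝ) ∂μ)) := by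
    refine tendsto_integral_of_dominated_convergence B
      (fun n => ((hai n).inf hBi).aestronglyMeasurable) hBi ?_ ?_
    · intro n
      filter_upwards [ha0 n, hB0] with x h1 h2
      rw [Real.norm_eq_abs, abs_of_nonneg (le_min h1 h2)]
      exact min_le_right _ _
    · filter_upwards [hal, hB0] with x h1 h2
      have := h1.min (tendsto_const_nhds (x := B x))
      rwa [min_eq_left h2] at this
  have h2 : Tendsto (fun n => ∫ x, max (B x - b n x) 0 ∂μ) atTop (nhds (∫ x, (0:ℝ) ∂μ)) := by
    refine tendsto_integral_of_dominated_convergence B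
      (fun n => ((hBi.sub (hbi n)).pos_part).aestronglyMeasurable) hBi ?_ ?_
    · intro n
      filter_upwards [ha0 n, hab n, hB0] with x h1 h2 h3
      rw [Real.norm_eq_abs, abs_of_nonneg (le_max_right _ _)]
      exact max_le (by linarith) h3
    · filter_upwards [hbl] with x h1
      have := ((tendsto_const_nhds (x := B x)).sub h1).max (tendsto_const_nhds (x := (0:ℝ)))
      simpa using this
  have h3 : Tendsto (fun n => ∫ x, min (a n x) (B x) ∂μ + (∫ x, b n x ∂μ - ∫ x, B x ∂μ)
      + ∫ x, max (B x - b n x) 0 ∂μ) atTop (nhds 0) := by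
    have := (h1.add (hint.sub_const (∫ x, B x ∂μ))).add h2
    simpa using this
  refine squeeze_zero (fun n => integral_nonneg_of_ae (ha0 n)) (fun n => ?_) h3
  have i1 : Integrable (fun x => min (a n x) (B x)) μ := (hai n).inf hBi
  have i2 : Integrable (fun x => max (B x - b n x) 0) μ := (hBi.sub (hbi n)).pos_part
  have i3 : Integrable (fun x => b n x - B x) μ := (hbi n).sub hBi
  rw [← integral_sub (hbi n) hBi, ← integral_add i1 i3,
    ← integral_add (f := fun x => min (a n x) (B x) + (b n x - B x)) (i1.add i3) i2]
  refine integral_mono_ae (hai n) ((i1.add i3).add i2) ?_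
  filter_upwards [hab n] with x h
  rcases le_total (a n x) (B x) with h' | h'
  · rw [min_eq_left h']; have := le_max_left (B x - b n x) 0; linarith
  · rw [min_eq_right h']; have := le_max_right (B x - b n x) 0; linarith

theorem opt (x a b θ : ℝ) (ha : 0 ≤ a) (hb : 0 ≤ b) (h0 : 0 < θ) (h1 : θ < 1)
    (h : ∀ q : ℚ, 0 < q → x ≤ θ * ((q:ℝ) ^ (1-θ) * a) + (1-θ) * ((q:ℝ) ^ (-θ) * b)) :
    x ≤ a ^ θ * b ^ (1-θ) := by
  have h' : ∀ t : ℝ, 0 < t → x ≤ θ * (t ^ (1-θ) * a) + (1-θ) * (t ^ (-θ) * b) := by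
    intro t ht
    obtain ⟨u, hu, hlim⟩ : ∃ u : ℕ → ℚ, (∀ n, t < u n) ∧
        Tendsto (fun n => (u n : ℝ)) atTop (nhds t) := by
      obtain ⟨u, -, hu, hl⟩ := Real.exists_seq_rat_strictAnti_tendsto t
      exact ⟨u, hu, hl⟩
    refine ge_of_tendsto (f := fun n : ℕ => θ * ((u n:ℝ) ^ (1-θ) * a) + (1-θ) * ((u n:ℝ) ^ (-θ) * b)) (x := atTop) ?_
      (Eventually.of_forall fun n => h (u n) ?_)
    · exact (((hlim.rpow_const (Or.inl ht.ne')).mul_const a).const_mul θ).add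
        (((hlim.rpow_const (Or.inl ht.ne')).mul_const b).const_mul (1-θ))
    · exact_mod_cast ht.trans (hu n)
  have h2 : ∀ ε : ℝ, 0 < ε → x ≤ (a+ε) ^ θ * (b+ε) ^ (1-θ) := by
    intro ε hε
    have pa : 0 < a + ε := by linarith
    have pb : 0 < b + ε := by linarith
    have key := h' ((b+ε)/(a+ε)) (by positivity)
    have e1 : ((b+ε)/(a+ε)) ^ (1-θ) * (a+ε) = (a+ε) ^ θ * (b+ε) ^ (1-θ) := by
      rw [Real.div_rpow pb.le pa.le, Real.rpow_sub pa, Real.rpow_one]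
      field_simp
    have e2 : ((b+ε)/(a+ε)) ^ (-θ) * (b+ε) = (a+ε) ^ θ * (b+ε) ^ (1-θ) := by
      rw [Real.div_rpow pb.le pa.le, Real.rpow_sub pb, Real.rpow_one, Real.rpow_neg pb.le,
        Real.rpow_neg pa.le]
      field_simp
    have l1 : ((b+ε)/(a+ε)) ^ (1-θ) * a ≤ ((b+ε)/(a+ε)) ^ (1-θ) * (a+ε) := by
      gcongr; linarith
    have l2 : ((b+ε)/(a+ε)) ^ (-θ) * b ≤ ((b+ε)/(a+ε)) ^ (-θ) * (b+ε) := by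
      gcongr; linarith
    rw [e1] at l1
    rw [e2] at l2
    nlinarith [mul_le_mul_of_nonneg_left l1 h0.le,
      mul_le_mul_of_nonneg_left l2 (sub_pos.2 h1).le]
  have hc : Continuous (fun ε : ℝ => (a+ε) ^ θ * (b+ε) ^ (1-θ)) := by
    refine Continuous.mul ?_ ?_
    · exact (continuous_const.add continuous_id).rpow_const (fun _ => Or.inr h0.le)
    · exact (continuous_const.add continuous_id).rpow_const (fun _ => Or.inr (by linarith))
  have ht : Tendsto (fun ε : ℝ => (a+ε) ^ θ * (b+ε) ^ (1-θ)) (nhdsWithin 0 (Set.Ioi 0))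
      (nhds (a ^ θ * b ^ (1-θ))) := by
    have := (hc.tendsto 0).mono_left (nhdsWithin_le_nhds (s := Set.Ioi 0))
    simpa using this
  exact ge_of_tendsto ht (by filter_upwards [self_mem_nhdsWithin] with ε hε using h2 ε hε)

theorem condHolder {Ω : Type*} {m m0 : MeasurableSpace Ω} {μ : Measure Ω} [IsProbabilityMeasure μ]
    (U W f : Ω → ℝ) (θ : ℝ) (h0 : 0 < θ) (h1 : θ < 1)
    (hU : Integrable U μ) (hW : Integrable W μ) (hf : Integrable f μ)
    (hU0 : ∀ x, 0 ≤ U x) (hW0 : ∀ x, 0 ≤ W x)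
    (hle : ∀ x, |f x| ≤ U x ^ θ * W x ^ (1-θ)) :
    ∀ᵐ x ∂μ, |(μ[f|m]) x| ≤ (μ[U|m]) x ^ θ * (μ[W|m]) x ^ (1-θ) := by
  have hq : ∀ q : ℚ, 0 < q → ∀ᵐ x ∂μ,
      |(μ[f|m]) x| ≤ θ * ((q:ℝ) ^ (1-θ) * (μ[U|m]) x) + (1-θ) * ((q:ℝ) ^ (-θ) * (μ[W|m]) x) := by
    intro q hq
    have hq' : (0:ℝ) < q := by exact_mod_cast hq
    set c := θ * (q:ℝ) ^ (1-θ)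
    set d := (1-θ) * (q:ℝ) ^ (-θ)
    have hyoung : ∀ x, |f x| ≤ c * U x + d * W x := by
      intro x
      refine (hle x).trans ?_
      have := Real.geom_mean_le_arith_mean2_weighted h0.le (sub_pos.2 h1).le
        (p₁ := (q:ℝ) ^ (1-θ) * U x) (p₂ := (q:ℝ) ^ (-θ) * W x)
        (mul_nonneg (by positivity) (hU0 x)) (mul_nonneg (by positivity) (hW0 x)) (by ring)
      rw [Real.mul_rpow (by positivity) (hU0 x), Real.mul_rpow (by positivity) (hW0 x),
        ← Real.rpow_mul hq'.le, ← Real.rpow_mul hq'.le] at this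
      have e : (q:ℝ) ^ ((1-θ)*θ) * (q:ℝ) ^ (-θ * (1-θ)) = 1 := by
        rw [← Real.rpow_add hq']; ring_nf; simp
      calc U x ^ θ * W x ^ (1-θ) = ((q:ℝ) ^ ((1-θ)*θ) * (q:ℝ) ^ (-θ * (1-θ))) * (U x ^ θ * W x ^ (1-θ)) := by rw [e, one_mul]
        _ ≤ _ := by simp only [c, d]; linarith
    have hI : Integrable (c • U + d • W) μ := (hU.smul c).add (hW.smul d)
    have m1 := condExp_mono (m := m) hf hI (Eventually.of_forall fun x => by
      simpa using (le_abs_self _).trans (hyoung x))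
    have m2 := condExp_mono (m := m) hf.neg hI (Eventually.of_forall fun x => by
      simpa using (neg_le_abs _).trans (hyoung x))
    filter_upwards [m1, m2, condExp_neg (m := m) (μ := μ) f, condExp_add (hU.smul c) (hW.smul d) m,
      condExp_smul (μ := μ) c U m, condExp_smul (μ := μ) d W m] with x k1 k2 k3 k4 k5 k6
    simp only [Pi.add_apply, Pi.smul_apply, Pi.neg_apply, smul_eq_mul] at k1 k2 k3 k4 k5 k6
    rw [k4, k5, k6] at k1 k2
    rw [k3] at k2
    rw [abs_le]
    simp only [c, d] at k1 k2
    constructor <;> linarith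
  have hall : ∀ᵐ x ∂μ, ∀ q : ℚ, 0 < q → 
      |(μ[f|m]) x| ≤ θ * ((q:ℝ) ^ (1-θ) * (μ[U|m]) x) + (1-θ) * ((q:ℝ) ^ (-θ) * (μ[W|m]) x) := by
    rw [ae_all_iff]; intro q
    by_cases hq0 : 0 < q
    · filter_upwards [hq q hq0] with x hx _ using hx
    · exact Eventually.of_forall fun x h => absurd h hq0
  filter_upwards [hall, condExp_nonneg (m := m) (μ := μ) (f := U) (Eventually.of_forall hU0),
    condExp_nonneg (m := m) (μ := μ) (f := W) (Eventually.of_forall hW0)] with x h hu hw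
  exact opt _ _ _ θ hu hw h0 h1 h

theorem pull {Ω : Type*} {m m0 : MeasurableSpace Ω} {μ : Measure Ω} [IsProbabilityMeasure μ]
    (hm : m ≤ m0) (h v : Ω → ℝ) (hh : StronglyMeasurable[m] h) (h0 : ∀ x, 0 ≤ h x)
    (hv : Integrable v μ) (hv0 : ∀ x, 0 ≤ v x)
    (hI : Integrable (fun x => h x * (μ[v|m]) x) μ) :
    Integrable (fun x => h x * v x) μ ∧ ∫ x, h x * v x ∂μ = ∫ x, h x * (μ[v|m]) x ∂μ := by
  have hE0 : 0 ≤ᵐ[μ] μ[v|m] := condExp_nonneg (Eventually.of_forall hv0)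
  have key : ∀ k : Ω → ℝ≥0∞, Measurable[m] k →
      ∫⁻ x, k x * ENNReal.ofReal (v x) ∂μ = ∫⁻ x, k x * ENNReal.ofReal ((μ[v|m]) x) ∂μ := by
    intro k hk
    have am1 : AEMeasurable (fun x => ENNReal.ofReal (v x)) μ := hv.aemeasurable.ennreal_ofReal
    have am2 : AEMeasurable (fun x => ENNReal.ofReal ((μ[v|m]) x)) μ :=
      (integrable_condExp (m := m) (μ := μ) (f := v)).aemeasurable.ennreal_ofReal
    have e : (μ.withDensity (fun x => ENNReal.ofReal (v x))).trim hm
        = (μ.withDensity (fun x => ENNReal.ofReal ((μ[v|m]) x))).trim hm := by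
      refine @Measure.ext _ m _ _ fun s hs => ?_
      rw [trim_measurableSet_eq hm hs, trim_measurableSet_eq hm hs,
        withDensity_apply _ (hm s hs), withDensity_apply _ (hm s hs),
        ← ofReal_integral_eq_lintegral_ofReal hv.integrableOn (Eventually.of_forall hv0),
        ← ofReal_integral_eq_lintegral_ofReal integrable_condExp.integrableOn (ae_restrict_of_ae hE0),
        setIntegral_condExp hm hv hs]
    have hk' : Measurable k := hk.mono hm le_rfl
    have := congrArg (fun ν => @lintegral Ω m ν k) e
    simp only [lintegral_trim hm hk] at this
    rw [lintegral_withDensity_eq_lintegral_mul₀ am1 hk'.aemeasurable,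
      lintegral_withDensity_eq_lintegral_mul₀ am2 hk'.aemeasurable] at this
    simpa [mul_comm] using this
  have k1 := key (fun x => ENNReal.ofReal (h x)) hh.measurable.ennreal_ofReal
  simp only [← ENNReal.ofReal_mul (h0 _)] at k1
  have n1 : 0 ≤ᵐ[μ] fun x => h x * v x := Eventually.of_forall fun x => mul_nonneg (h0 x) (hv0 x)
  have n2 : 0 ≤ᵐ[μ] fun x => h x * (μ[v|m]) x := by
    filter_upwards [hE0] with x hx using mul_nonneg (h0 x) hx
  have ms : AEStronglyMeasurable (fun x => h x * v x) μ :=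
    (hh.mono hm).aestronglyMeasurable.mul hv.aestronglyMeasurable
  refine ⟨⟨ms, ?_⟩, ?_⟩
  · rw [hasFiniteIntegral_iff_ofReal n1, k1, ← hasFiniteIntegral_iff_ofReal n2]
    exact hI.2
  · rw [integral_eq_lintegral_of_nonneg_ae n1 ms, integral_eq_lintegral_of_nonneg_ae n2 hI.1, k1]

theorem lim_ae {Ω : Type*} {m0 : MeasurableSpace Ω} {μ : Measure Ω} [IsProbabilityMeasure μ]
    (ℱ : Filtration ℕ m0) (hgen : m0 = ⨆ n, ℱ n) (h : Ω → ℝ) (hh : Integrable h μ) :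
    ∀ᵐ x ∂μ, Tendsto (fun n => (μ[h|ℱ n]) x) atTop (nhds (h x)) := by
  have h1 : μ[h|⨆ n, ℱ n] =ᵐ[μ] h := by
    refine condExp_of_aestronglyMeasurable' (hgen ▸ le_rfl) ?_ hh
    have : ∀ m : MeasurableSpace Ω, m0 = m → AEStronglyMeasurable[m] h μ := by
      rintro m rfl; exact hh.aestronglyMeasurable
    exact this _ hgen
  filter_upwards [tendsto_ae_condExp (μ := μ) (ℱ := ℱ) h, h1] with x k1 k2
  rwa [k2] at k1

theorem factor (w f q : ℝ) (hw : 0 < w) (hq : 1 < q) :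
    |f| = (|f| ^ q * w) ^ (1/q) * (w ^ (-(1/(q-1)))) ^ (1 - 1/q) := by
  have hq0 : q ≠ 0 := by linarith
  have hq1 : q - 1 ≠ 0 := by linarith
  rw [Real.mul_rpow (by positivity) hw.le, ← Real.rpow_mul (abs_nonneg f), ← Real.rpow_mul hw.le,
    mul_assoc, ← Real.rpow_add hw]
  have e1 : q * (1/q) = 1 := by field_simp
  have e2 : 1/q + -(1/(q-1)) * (1 - 1/q) = 0 := by field_simp; ring
  rw [e1, e2]; simp

theorem abs_sub_rpow_le (x y p : ℝ) (hp : 0 < p) :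
    |x - y| ^ p ≤ 2 ^ p * (|x| ^ p + |y| ^ p) := by
  have h1 : |x - y| ≤ 2 * max |x| |y| := by
    have := abs_sub x y
    have := le_max_left |x| |y|
    have := le_max_right |x| |y|
    linarith
  have hm : 0 ≤ max |x| |y| := le_max_of_le_left (abs_nonneg x)
  calc |x - y| ^ p ≤ (2 * max |x| |y|) ^ p := Real.rpow_le_rpow (abs_nonneg _) h1 hp.le
    _ = 2 ^ p * (max |x| |y|) ^ p := Real.mul_rpow (by norm_num) hm
    _ ≤ _ := by
      gcongr
      rcases max_choice |x| |y| with h | h <;> rw [h]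
      · have : 0 ≤ |y| ^ p := by positivity
        linarith
      · have : 0 ≤ |x| ^ p := by positivity
        linarith

theorem pt (a b V A B S T p p₁ p₂ C : ℝ) (hp0 : 0 < p) (hp1 : 1 < p₁) (hp2 : 1 < p₂)
    (hθ : p / p₁ + p / p₂ = 1) (hV : 0 ≤ V) (hA : 0 ≤ A) (hB : 0 ≤ B) (hS : 0 ≤ S) (hT : 0 ≤ T)
    (ha : |a| ≤ A ^ (1/p₁) * S ^ (1 - 1/p₁)) (hb : |b| ≤ B ^ (1/p₂) * T ^ (1 - 1/p₂))
    (hC : V ^ (1/p) * S ^ ((p₁-1)/p₁) * T ^ ((p₂-1)/p₂) ≤ C) :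
    |a * b| ^ p * V ≤ C ^ p * (p/p₁ * A + p/p₂ * B) := by
  have e1 : (p₁-1)/p₁ = 1 - 1/p₁ := by field_simp
  have e2 : (p₂-1)/p₂ = 1 - 1/p₂ := by field_simp
  rw [e1, e2] at hC
  have hVp : V = (V ^ (1/p)) ^ p := by
    rw [← Real.rpow_mul hV, one_div_mul_cancel hp0.ne', Real.rpow_one]
  have hA' : (A ^ (1/p₁)) ^ p = A ^ (p/p₁) := by
    rw [← Real.rpow_mul hA]; congr 1; ring
  have hB' : (B ^ (1/p₂)) ^ p = B ^ (p/p₂) := by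
    rw [← Real.rpow_mul hB]; congr 1; ring
  have hVn : 0 ≤ V ^ (1/p) := by positivity
  have hl : |a * b| * V ^ (1/p) ≤ C * (A ^ (1/p₁) * B ^ (1/p₂)) := by
    rw [abs_mul]
    calc |a| * |b| * V ^ (1/p)
        ≤ (A ^ (1/p₁) * S ^ (1 - 1/p₁)) * (B ^ (1/p₂) * T ^ (1 - 1/p₂)) * V ^ (1/p) := by gcongr
      _ = (V ^ (1/p) * S ^ (1 - 1/p₁) * T ^ (1 - 1/p₂)) * (A ^ (1/p₁) * B ^ (1/p₂)) := by ring
      _ ≤ _ := by gcongr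
  have hC0 : 0 ≤ C := le_trans (by positivity) hC
  calc |a * b| ^ p * V = (|a * b| * V ^ (1/p)) ^ p := by
        rw [Real.mul_rpow (abs_nonneg _) hVn, ← hVp]
    _ ≤ (C * (A ^ (1/p₁) * B ^ (1/p₂))) ^ p := Real.rpow_le_rpow (by positivity) hl hp0.le
    _ = C ^ p * (A ^ (p/p₁) * B ^ (p/p₂)) := by
        rw [Real.mul_rpow hC0 (by positivity), Real.mul_rpow (by positivity) (by positivity), hA', hB']
    _ ≤ _ := by
        gcongr
        exact Real.geom_mean_le_arith_mean2_weighted (by positivity) (by positivity) hA hB hθ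

theorem stmt_13
    {Ω : Type*} {m0 : MeasurableSpace Ω} {μ : Measure Ω} [IsProbabilityMeasure μ]
    (ℱ : Filtration ℕ m0) (hgen : m0 = ⨆ n, ℱ n)
    (ω₁ ω₂ v : Ω → ℝ)
    (hω₁ : ∀ x, 0 < ω₁ x) (hω₂ : ∀ x, 0 < ω₂ x)
    (hω₁I : Integrable ω₁ μ) (hω₂I : Integrable ω₂ μ)
    (p p₁ p₂ C : ℝ) (hp₁ : 1 < p₁) (hp₂ : 1 < p₂)
    (hp : 1 / p = 1 / p₁ + 1 / p₂) (hC : 0 < C)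
    (hσ₁I : Integrable (fun x => ω₁ x ^ (-(1 / (p₁ - 1)))) μ)
    (hσ₂I : Integrable (fun x => ω₂ x ^ (-(1 / (p₂ - 1)))) μ)
    (hvdef : v = fun x => ω₁ x ^ (p / p₁) * ω₂ x ^ (p / p₂))
    (hA : ∀ n : ℕ, ∀ᵐ x ∂μ,
      (μ[v|ℱ n]) x ^ (1 / p)
        * (μ[fun y => ω₁ y ^ (-(1 / (p₁ - 1)))|ℱ n]) x ^ ((p₁ - 1) / p₁)
        * (μ[fun y => ω₂ y ^ (-(1 / (p₂ - 1)))|ℱ n]) x ^ ((p₂ - 1) / p₂) ≤ C) :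
    ∀ f g : Ω → ℝ, Integrable f μ →
      Integrable (fun x => |f x| ^ p₁ * ω₁ x) μ →
      Integrable g μ →
      Integrable (fun x => |g x| ^ p₂ * ω₂ x) μ →
      Tendsto (fun n : ℕ => ∫ x, |(μ[f|ℱ n]) x * (μ[g|ℱ n]) x - f x * g x| ^ p * v x ∂μ)
        atTop (nhds 0) := by
  intro f g hf hF hg hG
  have hp0 : 0 < p := by
    rw [← one_div_pos, hp]; positivity
  have hθ : p / p₁ + p / p₂ = 1 := by
    have : p * (1 / p) = 1 := by field_simp
    rw [hp] at this
    rw [← this]; ring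
  have ht1 : 0 ≤ p / p₁ := by positivity
  have ht2 : 0 ≤ p / p₂ := by positivity
  have hv0 : ∀ x, 0 ≤ v x := fun x => by
    rw [hvdef]
    exact mul_nonneg (Real.rpow_nonneg (hω₁ x).le _) (Real.rpow_nonneg (hω₂ x).le _)
  have hvI : Integrable v μ := by
    refine ((hω₁I.const_mul (p/p₁)).add (hω₂I.const_mul (p/p₂))).mono' ?_ ?_
    · rw [hvdef]
      exact ((hω₁I.aemeasurable.pow_const _).mul (hω₂I.aemeasurable.pow_const _)).aestronglyMeasurable
    · refine Eventually.of_forall fun x => ?_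
      rw [Real.norm_eq_abs, abs_of_nonneg (hv0 x), hvdef]
      exact Real.geom_mean_le_arith_mean2_weighted ht1 ht2 (hω₁ x).le (hω₂ x).le hθ
  have hF0 : ∀ x, 0 ≤ |f x| ^ p₁ * ω₁ x := fun x => mul_nonneg (by positivity) (hω₁ x).le
  have hG0 : ∀ x, 0 ≤ |g x| ^ p₂ * ω₂ x := fun x => mul_nonneg (by positivity) (hω₂ x).le
  have hS0 : ∀ x, 0 ≤ ω₁ x ^ (-(1 / (p₁ - 1))) := fun x => Real.rpow_nonneg (hω₁ x).le _
  have hT0 : ∀ x, 0 ≤ ω₂ x ^ (-(1 / (p₂ - 1))) := fun x => Real.rpow_nonneg (hω₂ x).le _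
  have hr1 : 1 / p₁ < 1 := by rw [div_lt_one (by linarith)]; exact hp₁
  have hr2 : 1 / p₂ < 1 := by rw [div_lt_one (by linarith)]; exact hp₂
  -- main pointwise bound
  have hYle : ∀ n, ∀ᵐ x ∂μ, |(μ[f|ℱ n]) x * (μ[g|ℱ n]) x| ^ p * (μ[v|ℱ n]) x ≤
      C ^ p * (p/p₁ * (μ[fun x => |f x| ^ p₁ * ω₁ x|ℱ n]) x
        + p/p₂ * (μ[fun x => |g x| ^ p₂ * ω₂ x|ℱ n]) x) := by
    intro n
    filter_upwards [hA n,
      condHolder (m := ℱ n) _ _ f (1/p₁) (by positivity) hr1 hF hσ₁I hf hF0 hS0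
        (fun x => (factor (ω₁ x) (f x) p₁ (hω₁ x) hp₁).le),
      condHolder (m := ℱ n) _ _ g (1/p₂) (by positivity) hr2 hG hσ₂I hg hG0 hT0
        (fun x => (factor (ω₂ x) (g x) p₂ (hω₂ x) hp₂).le),
      condExp_nonneg (m := ℱ n) (μ := μ) (Eventually.of_forall hv0),
      condExp_nonneg (m := ℱ n) (μ := μ) (Eventually.of_forall hF0),
      condExp_nonneg (m := ℱ n) (μ := μ) (Eventually.of_forall hG0),
      condExp_nonneg (m := ℱ n) (μ := μ) (Eventually.of_forall hS0),
      condExp_nonneg (m := ℱ n) (μ := μ) (Eventually.of_forall hT0)]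
      with x h1 h2 h3 h4 h5 h6 h7 h8
    exact pt _ _ _ _ _ _ _ p p₁ p₂ C hp0 hp₁ hp₂ hθ h4 h5 h6 h7 h8 h2 h3 h1
  set F : Ω → ℝ := fun x => |f x| ^ p₁ * ω₁ x with hFd
  set G : Ω → ℝ := fun x => |g x| ^ p₂ * ω₂ x with hGd
  have hYl : ∀ x, |f x * g x| ^ p * v x ≤ p/p₁ * F x + p/p₂ * G x := by
    intro x
    have e : |f x * g x| ^ p * v x = F x ^ (p/p₁) * G x ^ (p/p₂) := by
      simp only [hFd, hGd, hvdef]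
      rw [Real.mul_rpow (by positivity) (hω₁ x).le, Real.mul_rpow (by positivity) (hω₂ x).le,
        ← Real.rpow_mul (abs_nonneg _), ← Real.rpow_mul (abs_nonneg _), abs_mul,
        Real.mul_rpow (abs_nonneg _) (abs_nonneg _), mul_div_cancel₀ p (by linarith : p₁ ≠ 0),
        mul_div_cancel₀ p (by linarith : p₂ ≠ 0)]
      ring
    rw [e]
    exact Real.geom_mean_le_arith_mean2_weighted ht1 ht2 (hF0 x) (hG0 x) hθ
  have hYl0 : ∀ x, 0 ≤ |f x * g x| ^ p * v x := fun x => mul_nonneg (by positivity) (hv0 x)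
  have hYlI : Integrable (fun x => |f x * g x| ^ p * v x) μ := by
    refine ((hF.const_mul (p/p₁)).add (hG.const_mul (p/p₂))).mono' ?_ ?_
    · exact (((hf.aemeasurable.mul hg.aemeasurable).abs.pow_const _).mul
        hvI.aemeasurable).aestronglyMeasurable
    · refine Eventually.of_forall fun x => ?_
      rw [Real.norm_eq_abs, abs_of_nonneg (hYl0 x)]
      exact hYl x
  have hYm : ∀ n, AEStronglyMeasurable
      (fun x => |(μ[f|ℱ n]) x * (μ[g|ℱ n]) x| ^ p * (μ[v|ℱ n]) x) μ := fun n =>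
    (((integrable_condExp.aemeasurable.mul integrable_condExp.aemeasurable).abs.pow_const _).mul
        integrable_condExp.aemeasurable).aestronglyMeasurable
  have hY0 : ∀ n, ∀ᵐ x ∂μ, 0 ≤ |(μ[f|ℱ n]) x * (μ[g|ℱ n]) x| ^ p * (μ[v|ℱ n]) x := fun n => by
    filter_upwards [condExp_nonneg (m := ℱ n) (μ := μ) (Eventually.of_forall hv0)] with x hx
    exact mul_nonneg (by positivity) hx
  have hHI : ∀ n, Integrable (fun x => C ^ p * (p/p₁ * (μ[F|ℱ n]) x + p/p₂ * (μ[G|ℱ n]) x)) μ :=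
    fun n => ((integrable_condExp.const_mul _).add (integrable_condExp.const_mul _)).const_mul _
  have hHlI : Integrable (fun x => C ^ p * (p/p₁ * F x + p/p₂ * G x)) μ :=
    ((hF.const_mul _).add (hG.const_mul _)).const_mul _
  have hHint : ∀ n, ∫ x, C ^ p * (p/p₁ * (μ[F|ℱ n]) x + p/p₂ * (μ[G|ℱ n]) x) ∂μ =
      ∫ x, C ^ p * (p/p₁ * F x + p/p₂ * G x) ∂μ := by
    intro n
    rw [integral_const_mul, integral_const_mul,
      integral_add (integrable_condExp.const_mul _) (integrable_condExp.const_mul _),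
      integral_add (hF.const_mul _) (hG.const_mul _)]
    simp only [integral_const_mul]
    rw [integral_condExp (ℱ.le n), integral_condExp (ℱ.le n)]
  have hYI : ∀ n, Integrable
      (fun x => |(μ[f|ℱ n]) x * (μ[g|ℱ n]) x| ^ p * (μ[v|ℱ n]) x) μ := fun n => by
    refine (hHI n).mono' (hYm n) ?_
    filter_upwards [hY0 n, hYle n] with x h1 h2
    rwa [Real.norm_eq_abs, abs_of_nonneg h1]
  have hpull := fun n => pull (ℱ.le n) (fun x => |(μ[f|ℱ n]) x * (μ[g|ℱ n]) x| ^ p) v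
    ((continuous_abs.rpow_const (fun _ => Or.inr hp0.le)).comp_stronglyMeasurable
      ((stronglyMeasurable_condExp (m := ℱ n) (μ := μ) (f := f)).mul
        (stronglyMeasurable_condExp (m := ℱ n) (μ := μ) (f := g))))
    (fun x => by positivity) hvI hv0 (hYI n)
  have lf := lim_ae ℱ hgen f hf
  have lg := lim_ae ℱ hgen g hg
  have lv := lim_ae ℱ hgen v hvI
  have lF := lim_ae ℱ hgen F hF
  have lG := lim_ae ℱ hgen G hG
  have hX : ∀ᵐ x ∂μ, Tendsto (fun n => |(μ[f|ℱ n]) x * (μ[g|ℱ n]) x| ^ p) atTop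
      (nhds (|f x * g x| ^ p)) := by
    filter_upwards [lf, lg] with x h1 h2
    exact (h1.mul h2).abs.rpow_const (Or.inr hp0.le)
  have step1 : Tendsto (fun n => ∫ x, |(|(μ[f|ℱ n]) x * (μ[g|ℱ n]) x| ^ p * (μ[v|ℱ n]) x)
      - |f x * g x| ^ p * v x| ∂μ) atTop (nhds 0) := by
    refine gdct _ (fun n x => C ^ p * (p/p₁ * (μ[F|ℱ n]) x + p/p₂ * (μ[G|ℱ n]) x)
        + |f x * g x| ^ p * v x)
      (fun x => C ^ p * (p/p₁ * F x + p/p₂ * G x) + |f x * g x| ^ p * v x)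
      (fun n => ((hYI n).sub hYlI).abs.aestronglyMeasurable)
      (fun n => (hHI n).add hYlI) (hHlI.add hYlI)
      (fun n => Eventually.of_forall fun x => abs_nonneg _) ?_ ?_ ?_ ?_ ?_
    · intro n
      filter_upwards [hY0 n, hYle n] with x h1 h2
      have := hYl0 x
      rw [abs_le]; constructor <;> linarith
    · refine Eventually.of_forall fun x => add_nonneg ?_ (hYl0 x)
      exact mul_nonneg (by positivity) ((hYl0 x).trans (hYl x))
    · filter_upwards [hX, lv] with x h1 h2
      have := ((h1.mul h2).sub_const (|f x * g x| ^ p * v x)).abs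
      simpa using this
    · filter_upwards [lF, lG] with x h1 h2
      exact (((h1.const_mul _).add (h2.const_mul _)).const_mul _).add_const _
    · have : ∀ n, ∫ x, (C ^ p * (p/p₁ * (μ[F|ℱ n]) x + p/p₂ * (μ[G|ℱ n]) x)
        + |f x * g x| ^ p * v x) ∂μ =
          ∫ x, (C ^ p * (p/p₁ * F x + p/p₂ * G x) + |f x * g x| ^ p * v x) ∂μ := fun n => by
        rw [integral_add (hHI n) hYlI, integral_add hHlI hYlI, hHint n]
      simp only [this]
      exact tendsto_const_nhds
  have step2 : Tendsto (fun n => ∫ x, |(μ[f|ℱ n]) x * (μ[g|ℱ n]) x| ^ p * v x ∂μ) atTop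
      (nhds (∫ x, |f x * g x| ^ p * v x ∂μ)) := by
    rw [tendsto_iff_norm_sub_tendsto_zero]
    refine squeeze_zero (fun n => norm_nonneg _) (fun n => ?_) step1
    rw [(hpull n).2, ← integral_sub (hYI n) hYlI]
    exact norm_integral_le_integral_norm _
  refine gdct _ (fun n x => 2 ^ p * (|(μ[f|ℱ n]) x * (μ[g|ℱ n]) x| ^ p * v x
      + |f x * g x| ^ p * v x))
    (fun x => 2 ^ p * (|f x * g x| ^ p * v x + |f x * g x| ^ p * v x)) ?_
    (fun n => ((hpull n).1.add hYlI).const_mul _) ((hYlI.add hYlI).const_mul _)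
    (fun n => Eventually.of_forall fun x => mul_nonneg (by positivity) (hv0 x)) ?_ ?_ ?_ ?_ ?_
  · intro n
    exact (((((integrable_condExp.aemeasurable.mul integrable_condExp.aemeasurable).sub
      (hf.aemeasurable.mul hg.aemeasurable))).abs.pow_const _).mul
        hvI.aemeasurable).aestronglyMeasurable
  · intro n
    refine Eventually.of_forall fun x => ?_
    have := mul_le_mul_of_nonneg_right
      (abs_sub_rpow_le ((μ[f|ℱ n]) x * (μ[g|ℱ n]) x) (f x * g x) p hp0) (hv0 x)
    linarith
  · exact Eventually.of_forall fun x =>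
      mul_nonneg (by positivity) (add_nonneg (hYl0 x) (hYl0 x))
  · filter_upwards [lf, lg] with x h1 h2
    have := ((((h1.mul h2).sub_const (f x * g x)).abs.rpow_const
      (p := p) (Or.inr hp0.le))).mul_const (v x)
    simpa [Real.zero_rpow hp0.ne'] using this
  · filter_upwards [hX] with x h1
    exact ((h1.mul_const _).add_const _).const_mul _
  · have := (step2.add_const (∫ x, |f x * g x| ^ p * v x ∂μ)).const_mul ((2:ℝ) ^ p)
    rw [← integral_add hYlI hYlI, ← integral_const_mul] at this
    refine this.congr fun n => ?_
    rw [← integral_add (hpull n).1 hYlI, ← integral_const_mul]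

end
end
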